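/- The four ℝ-algebras S₁ = ℝ[x,y,z]/(x² + y² + z² + 1), S₂ = ℝ[x,y,z]/(x² + y² + z² − 1), S₃ = ℝ[x,y,z]/(x² − y² + z² − 1) and S₄ = ℝ[x,y,z]/(x² − y² + z² + 1) are pairwise non-isomorphic, the complexification Sᵢ ⊗_ℝ ℂ of each is isomorphic as a ℂ-algebra to ℂ[x,y,z]/(xy − z² + 1), and every commutative ℝ-algebra whose complexification is isomorphic to ℂ[x,y,z]/(xy − z² + 1) as a ℂ-algebra is isomorphic to one of S₁, S₂, S₃, S₄. (Thus the complex surface xy = z² − 1 has exactly four isomorphism classes of real forms.) -/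

import Mathlib

open MvPolynomial
open scoped TensorProduct

/-- `A` is a real form of the complex algebra `B` if the complexification `ℂ ⊗[ℝ] A`
is isomorphic to `B` as a `ℂ`-algebra. -/
def IsRealForm (A : Type) [CommRing A] [Algebra ℝ A]
    (B : Type) [CommRing B] [Algebra ℂ B] : Prop :=
  Nonempty ((ℂ ⊗[ℝ] A) ≃ₐ[ℂ] B)

/-- The four real quadrics `x² ± y² + z² ± 1 = 0`. -/
noncomputable def quadric7 : Fin 4 → MvPolynomial (Fin 3) ℝ :=
  ![X 0 ^ 2 + X 1 ^ 2 + X 2 ^ 2 + 1,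
    X 0 ^ 2 + X 1 ^ 2 + X 2 ^ 2 - 1,
    X 0 ^ 2 - X 1 ^ 2 + X 2 ^ 2 - 1,
    X 0 ^ 2 - X 1 ^ 2 + X 2 ^ 2 + 1]

namespace QF

abbrev R1 := Polynomial ℂ
abbrev R2 := Polynomial (Polynomial ℂ)

structure Quad (B : Type) [CommRing B] [Algebra ℂ B] where
  x : B
  y : B
  z : B
  rel : x * y = z ^ 2 - 1
  gen : Algebra.adjoin ℂ {x, y, z} = ⊤
  lift : ∀ {R : Type} [CommRing R] [Algebra ℂ R] (a b c : R), a * b = c ^ 2 - 1 → (B →ₐ[ℂ] R)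
  lift_x : ∀ {R : Type} [CommRing R] [Algebra ℂ R] (a b c : R) (h : a * b = c ^ 2 - 1),
    lift a b c h x = a
  lift_y : ∀ {R : Type} [CommRing R] [Algebra ℂ R] (a b c : R) (h : a * b = c ^ 2 - 1),
    lift a b c h y = b
  lift_z : ∀ {R : Type} [CommRing R] [Algebra ℂ R] (a b c : R) (h : a * b = c ^ 2 - 1),
    lift a b c h z = c

attribute [simp] Quad.lift_x Quad.lift_y Quad.lift_z

namespace Quad

variable {B : Type} [CommRing B] [Algebra ℂ B] (S : Quad B)

theorem hom_ext {R : Type} [CommRing R] [Algebra ℂ R] {f g : B →ₐ[ℂ] R}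
    (hx : f S.x = g S.x) (hy : f S.y = g S.y) (hz : f S.z = g S.z) : f = g := by
  refine AlgHom.ext_of_adjoin_eq_top S.gen ?_
  rintro w (rfl | rfl | rfl) <;> assumption

theorem ind {P : B → Prop} (hc : ∀ c : ℂ, P (algebraMap ℂ B c)) (hx : P S.x) (hy : P S.y)
    (hz : P S.z) (ha : ∀ f g, P f → P g → P (f + g)) (hm : ∀ f g, P f → P g → P (f * g))
    (f : B) : P f := by
  have hf : f ∈ Algebra.adjoin ℂ {S.x, S.y, S.z} := by rw [S.gen]; trivial
  induction hf using Algebra.adjoin_induction with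
  | mem w hw => rcases hw with (rfl | rfl | rfl) <;> assumption
  | algebraMap c => exact hc c
  | add f g _ _ h1 h2 => exact ha f g h1 h2
  | mul f g _ _ h1 h2 => exact hm f g h1 h2

/-- automorphism from a hom with inverse on generators -/
noncomputable def mkEquiv (a b c a' b' c' : B) (h : a * b = c ^ 2 - 1) (h' : a' * b' = c' ^ 2 - 1)
    (h1 : S.lift a' b' c' h' a = S.x ∧ S.lift a' b' c' h' b = S.y ∧ S.lift a' b' c' h' c = S.z)
    (h2 : S.lift a b c h a' = S.x ∧ S.lift a b c h b' = S.y ∧ S.lift a b c h c' = S.z) :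
    B ≃ₐ[ℂ] B :=
  AlgEquiv.ofAlgHom (S.lift a b c h) (S.lift a' b' c' h')
    (S.hom_ext (by simp [h2]) (by simp [h2]) (by simp [h2]))
    (S.hom_ext (by simp [h1]) (by simp [h1]) (by simp [h1]))

noncomputable def iota : B →ₐ[ℂ] R2 :=
  S.lift (Polynomial.C Polynomial.X) (2 * Polynomial.X + Polynomial.C Polynomial.X * Polynomial.X ^ 2)
    (1 + Polynomial.C Polynomial.X * Polynomial.X) (by ring)

@[simp] theorem iota_x : S.iota S.x = Polynomial.C Polynomial.X := by simp [iota]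
@[simp] theorem iota_y : S.iota S.y =
  2 * Polynomial.X + Polynomial.C Polynomial.X * Polynomial.X ^ 2 := by simp [iota]
@[simp] theorem iota_z : S.iota S.z = 1 + Polynomial.C Polynomial.X * Polynomial.X := by
  simp [iota]

noncomputable def d (f : B) : ℕ := (S.iota f).natDegree

/-- outer variable T, inner variable t -/
noncomputable def kappa : B →ₐ[ℂ] R2 :=
  S.lift Polynomial.X
    (Polynomial.C (2 * Polynomial.X) + Polynomial.C (Polynomial.X ^ 2) * Polynomial.X)
    (1 + Polynomial.C Polynomial.X * Polynomial.X) (by simp only [map_mul, map_pow, map_ofNat]; ring)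

@[simp] theorem kappa_x : S.kappa S.x = Polynomial.X := by simp [kappa]
@[simp] theorem kappa_y : S.kappa S.y = Polynomial.C (2 * Polynomial.X) +
  Polynomial.C (Polynomial.X ^ 2) * Polynomial.X := by simp only [kappa, lift_y]
@[simp] theorem kappa_z : S.kappa S.z = 1 + Polynomial.C Polynomial.X * Polynomial.X := by
  simp [kappa]

noncomputable def swap : B ≃ₐ[ℂ] B :=
  S.mkEquiv S.y S.x S.z S.y S.x S.z (by rw [← S.rel]; ring) (by rw [← S.rel]; ring)
    (by simp) (by simp)

@[simp] theorem swap_x : S.swap S.x = S.y := by simp [swap, mkEquiv]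
@[simp] theorem swap_y : S.swap S.y = S.x := by simp [swap, mkEquiv]
@[simp] theorem swap_z : S.swap S.z = S.z := by simp [swap, mkEquiv]
@[simp] theorem swap_symm : S.swap.symm = S.swap := by
  ext f; rfl

noncomputable def scale (l : ℂ) (hl : l ≠ 0) : B ≃ₐ[ℂ] B :=
  S.mkEquiv (l • S.x) (l⁻¹ • S.y) S.z (l⁻¹ • S.x) (l • S.y) S.z
    (by rw [smul_mul_smul_comm, mul_inv_cancel₀ hl, one_smul, S.rel])
    (by rw [smul_mul_smul_comm, inv_mul_cancel₀ hl, one_smul, S.rel])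
    (by simp [smul_smul, hl]) (by simp [smul_smul, hl])

@[simp] theorem scale_x (l hl) : S.scale l hl S.x = l • S.x := by simp [scale, mkEquiv]
@[simp] theorem scale_y (l hl) : S.scale l hl S.y = l⁻¹ • S.y := by simp [scale, mkEquiv]
@[simp] theorem scale_z (l hl) : S.scale l hl S.z = S.z := by simp [scale, mkEquiv]
@[simp] theorem scale_symm_x (l hl) : (S.scale l hl).symm S.x = l⁻¹ • S.x := by
  simp [scale, mkEquiv]
@[simp] theorem scale_symm_y (l hl) : (S.scale l hl).symm S.y = l • S.y := by
  simp [scale, mkEquiv]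
@[simp] theorem scale_symm_z (l hl) : (S.scale l hl).symm S.z = S.z := by simp [scale, mkEquiv]

/-- triangular automorphism -/
noncomputable def tri (p : R1) : B ≃ₐ[ℂ] B :=
  S.mkEquiv S.x (S.y + 2 * S.z * Polynomial.aeval S.x p + S.x * Polynomial.aeval S.x p ^ 2)
    (S.z + S.x * Polynomial.aeval S.x p)
    S.x (S.y - 2 * S.z * Polynomial.aeval S.x p + S.x * Polynomial.aeval S.x p ^ 2)
    (S.z - S.x * Polynomial.aeval S.x p)
    (by linear_combination S.rel) (by linear_combination S.rel)
    (by
      simp only [map_add, map_mul, map_pow, lift_x, lift_y, lift_z, ← Polynomial.aeval_algHom_apply,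
        map_ofNat]
      refine ⟨trivial, by ring, by ring⟩)
    (by
      simp only [map_add, map_sub, map_mul, map_pow, lift_x, lift_y, lift_z,
        ← Polynomial.aeval_algHom_apply, map_ofNat]
      refine ⟨trivial, by ring, by ring⟩)

@[simp] theorem tri_x (p) : S.tri p S.x = S.x := by simp [tri, mkEquiv]
@[simp] theorem tri_z (p) : S.tri p S.z = S.z + S.x * Polynomial.aeval S.x p := by
  simp [tri, mkEquiv]
@[simp] theorem tri_y (p) : S.tri p S.y =
    S.y + 2 * S.z * Polynomial.aeval S.x p + S.x * Polynomial.aeval S.x p ^ 2 := by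
  simp [tri, mkEquiv]
@[simp] theorem tri_symm_x (p) : (S.tri p).symm S.x = S.x := by simp [tri, mkEquiv]
@[simp] theorem tri_symm_z (p) : (S.tri p).symm S.z = S.z - S.x * Polynomial.aeval S.x p := by
  simp [tri, mkEquiv]

theorem aeval_CX (p : R1) :
    Polynomial.aeval (Polynomial.C Polynomial.X : R2) p = Polynomial.C p := by
  have := Polynomial.aeval_algHom_apply (Polynomial.CAlgHom (R := ℂ) (A := R1)) Polynomial.X p
  simpa using this

theorem iota_tri (p : R1) (f : B) :
    S.iota (S.tri p f) = (S.iota f).comp (Polynomial.X + Polynomial.C p) := by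
  have : (S.iota.comp (S.tri p : B →ₐ[ℂ] B)) =
      ((Polynomial.aeval (R := R1) (Polynomial.X + Polynomial.C p : R2)).restrictScalars ℂ).comp
        S.iota := by
    refine S.hom_ext ?_ ?_ ?_
    · simp
    · simp [← Polynomial.aeval_algHom_apply, aeval_CX, map_ofNat]; ring
    · simp [← Polynomial.aeval_algHom_apply, aeval_CX, map_ofNat]; ring
  have h := DFunLike.congr_fun this f
  simpa [Polynomial.aeval_eq_sum_range, Polynomial.comp, Polynomial.eval₂_eq_sum_range,
    Polynomial.smul_eq_C_mul] using h

theorem d_tri (p : R1) (f : B) : S.d (S.tri p f) = S.d f := by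
  rw [d, iota_tri, Polynomial.natDegree_comp, Polynomial.natDegree_X_add_C, mul_one, d]

theorem d_tri_symm (p : R1) (f : B) : S.d ((S.tri p).symm f) = S.d f := by
  rw [← S.d_tri p, AlgEquiv.apply_symm_apply]

end Quad
end QF

namespace QF

noncomputable def ev {R : Type} [CommRing R] [Algebra ℂ R] (x z : R) (Q : R2) : R :=
  Q.eval₂ (Polynomial.aeval x : R1 →ₐ[ℂ] R).toRingHom z

theorem map_ev {R R' : Type} [CommRing R] [Algebra ℂ R] [CommRing R'] [Algebra ℂ R']
    (j : R →ₐ[ℂ] R') (x z : R) (Q : R2) : j (ev x z Q) = ev (j x) (j z) Q := by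
  unfold ev
  have := Polynomial.hom_eval₂ Q (Polynomial.aeval x : R1 →ₐ[ℂ] R).toRingHom (j : R →+* R') z
  simp only [RingHom.coe_coe] at this
  rw [this]
  congr 1
  ext <;> simp

theorem ev_CX (z : R2) (Q : R2) : ev (Polynomial.C Polynomial.X : R2) z Q = Q.comp z := by
  unfold ev Polynomial.comp
  congr 1
  ext p <;> simp [Quad.aeval_CX]

namespace Quad

variable {B : Type} [CommRing B] [Algebra ℂ B] (S : Quad B)

def V : Submodule ℂ B := Submodule.span ℂ {1, S.x, S.y, S.z}

theorem one_mem_V : (1 : B) ∈ S.V := Submodule.subset_span (by simp)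
theorem x_mem_V : S.x ∈ S.V := Submodule.subset_span (by simp)
theorem y_mem_V : S.y ∈ S.V := Submodule.subset_span (by simp)
theorem z_mem_V : S.z ∈ S.V := Submodule.subset_span (by simp)

theorem V_mono {m n : ℕ} (h : m ≤ n) : S.V ^ m ≤ S.V ^ n :=
  pow_le_pow_right' (by rw [Submodule.one_le]; exact S.one_mem_V) h

theorem exists_V (f : B) : ∃ m, f ∈ S.V ^ m := by
  refine S.ind (P := fun f => ∃ m, f ∈ S.V ^ m) ?_ ?_ ?_ ?_ ?_ ?_ f
  · intro c
    refine ⟨0, ?_⟩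
    rw [pow_zero]; exact Submodule.algebraMap_mem c
  · exact ⟨1, by simpa using S.x_mem_V⟩
  · exact ⟨1, by simpa using S.y_mem_V⟩
  · exact ⟨1, by simpa using S.z_mem_V⟩
  · rintro f g ⟨m, hm⟩ ⟨n, hn⟩
    exact ⟨max m n, add_mem (S.V_mono (le_max_left _ _) hm) (S.V_mono (le_max_right _ _) hn)⟩
  · rintro f g ⟨m, hm⟩ ⟨n, hn⟩
    exact ⟨m + n, by rw [pow_add]; exact Submodule.mul_mem_mul hm hn⟩

def c (w : ℕ) : B := S.y ^ (w / 2) * S.z ^ (w % 2)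
def b (m w : ℕ) : B := S.x ^ (m - (w + 1) / 2) * S.c w

theorem mono_mem (i j e : ℕ) : S.x ^ i * (S.y ^ j * S.z ^ e) ∈ S.V ^ (i + (j + e)) := by
  rw [pow_add, pow_add]
  exact Submodule.mul_mem_mul (Submodule.pow_mem_pow _ S.x_mem_V _)
    (Submodule.mul_mem_mul (Submodule.pow_mem_pow _ S.y_mem_V _)
      (Submodule.pow_mem_pow _ S.z_mem_V _))

theorem b_mem {m w : ℕ} (h : w ≤ 2 * m) : S.b m w ∈ S.V ^ m := by
  have := S.mono_mem (m - (w + 1) / 2) (w / 2) (w % 2)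
  rw [show m - (w + 1) / 2 + (w / 2 + w % 2) = m by omega] at this
  exact this

def Sm (m : ℕ) : Submodule ℂ B := Submodule.span ℂ (S.b m '' {w | w ≤ 2 * m})

theorem b_mem_Sm {m w : ℕ} (h : w ≤ 2 * m) : S.b m w ∈ S.Sm m :=
  Submodule.subset_span ⟨w, h, rfl⟩

theorem Sm_mul_V (m : ℕ) : S.Sm m * S.V ≤ S.Sm (m + 1) ⊔ S.V ^ m := by
  rw [Sm, V, Submodule.span_mul_span, Submodule.span_le]
  rintro _ ⟨_, ⟨w, hw, rfl⟩, v, hv, rfl⟩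
  simp only [Set.mem_ofPred_eq] at hw
  have hb : ∀ {w'}, w' ≤ 2 * (m + 1) → S.b (m+1) w' ∈ S.Sm (m + 1) ⊔ S.V ^ m :=
    fun h => Submodule.mem_sup_left (S.b_mem_Sm h)
  change S.b m w * v ∈ S.Sm (m + 1) ⊔ S.V ^ m
  rcases hv with rfl | rfl | rfl | rfl
  · rw [mul_one]; exact Submodule.mem_sup_right (S.b_mem hw)
  · have : S.b m w * S.x = S.b (m + 1) w := by
      simp only [b, show m + 1 - (w + 1) / 2 = m - (w + 1) / 2 + 1 by omega]; ring
    rw [this]; exact hb (by omega)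
  · have : S.b m w * S.y = S.b (m + 1) (w + 2) := by
      simp only [b, c, show m + 1 - (w + 2 + 1) / 2 = m - (w + 1) / 2 by omega,
        show (w + 2) / 2 = w / 2 + 1 by omega, show (w + 2) % 2 = w % 2 by omega]; ring
    rw [this]; exact hb (by omega)
  · rcases Nat.even_or_odd' w with ⟨k, rfl | rfl⟩
    · have : S.b m (2 * k) * S.z = S.b (m + 1) (2 * k + 1) := by
        simp only [b, c, show m + 1 - (2 * k + 1 + 1) / 2 = m - (2 * k + 1) / 2 by omega,
          show (2 * k + 1) / 2 = k by omega, show (2 * k + 1) % 2 = 1 by omega,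
          show (2 * k) / 2 = k by omega, show (2 * k) % 2 = 0 by omega]; ring
      rw [this]; exact hb (by omega)
    · have h0 : S.b m (2 * k + 1) * S.z = S.b (m + 1) (2 * k + 1 + 1) +
          S.x ^ (m - (k + 1)) * (S.y ^ k * S.z ^ 0) := by
        simp only [b, c, show m + 1 - (2 * k + 1 + 1 + 1) / 2 = m - (k + 1) + 1 by omega,
          show m - (2 * k + 1 + 1) / 2 = m - (k + 1) by omega,
          show (2 * k + 1) / 2 = k by omega, show (2 * k + 1) % 2 = 1 by omega,
          show (2 * k + 1 + 1) / 2 = k + 1 by omega, show (2 * k + 1 + 1) % 2 = 0 by omega]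
        have : S.z ^ 2 = S.x * S.y + 1 := by rw [S.rel]; ring
        linear_combination (S.x ^ (m - (k + 1)) * S.y ^ k) * this
      rw [h0]
      refine add_mem (hb (by omega)) (Submodule.mem_sup_right ?_)
      exact S.V_mono (by omega) (S.mono_mem (m - (k + 1)) k 0)

theorem V_pow_le (m : ℕ) : S.V ^ (m + 1) ≤ S.Sm (m + 1) ⊔ S.V ^ m := by
  induction m with
  | zero =>
    have h1 : (1 : Submodule ℂ B) ≤ S.Sm 0 := by
      rw [Submodule.one_le]
      have := S.b_mem_Sm (m := 0) (w := 0) (by simp)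
      simpa [b, c] using this
    calc S.V ^ (0 + 1) = 1 * S.V := by simp
      _ ≤ S.Sm 0 * S.V := mul_le_mul' h1 le_rfl
      _ ≤ _ := S.Sm_mul_V 0
  | succ m ih =>
    calc S.V ^ (m + 1 + 1) = S.V ^ (m + 1) * S.V := pow_succ _ _
      _ ≤ (S.Sm (m + 1) ⊔ S.V ^ m) * S.V := mul_le_mul' ih le_rfl
      _ = S.Sm (m + 1) * S.V ⊔ S.V ^ (m + 1) := by rw [Submodule.sup_mul, pow_succ]
      _ ≤ _ := sup_le (S.Sm_mul_V _) le_sup_right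

/-- degree bounds on powers of `V` -/
theorem pow_V_natDegree {A : Type} [CommRing A] [Algebra ℂ A]
    (j : B →ₐ[ℂ] Polynomial A) (k : ℕ)
    (hx : (j S.x).natDegree ≤ k) (hy : (j S.y).natDegree ≤ k) (hz : (j S.z).natDegree ≤ k)
    {m : ℕ} {f : B} (hf : f ∈ S.V ^ m) : (j f).natDegree ≤ m * k := by
  have hV : ∀ v ∈ S.V, (j v).natDegree ≤ k := by
    intro v hv
    induction hv using Submodule.span_induction with
    | mem v hv => rcases hv with rfl | rfl | rfl | rfl <;> simp [*]
    | zero => simp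
    | add a b _ _ ha hb => rw [map_add]; exact Polynomial.natDegree_add_le_of_degree_le ha hb
    | smul a v _ h => rw [map_smul]; exact (Polynomial.natDegree_smul_le _ _).trans h
  induction hf using Submodule.pow_induction_on_left' with
  | algebraMap r => simp [Polynomial.algebraMap_apply]
  | add a b i _ _ ha hb => rw [map_add]; exact Polynomial.natDegree_add_le_of_degree_le ha hb
  | mem_mul v hv i f _ h =>
    rw [map_mul]
    refine Polynomial.natDegree_mul_le.trans ?_
    have := hV v hv
    rw [Nat.succ_mul]; omega

theorem kappa_natDegree {m : ℕ} {f : B} (hf : f ∈ S.V ^ m) : (S.kappa f).natDegree ≤ m := by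
  have := S.pow_V_natDegree S.kappa 1 (by simp) (by rw [kappa_y]; compute_degree)
    (by rw [kappa_z]; compute_degree) hf
  simpa using this

theorem kappa_b {m w : ℕ} (h : w ≤ 2 * m) : (S.kappa (S.b m w)).coeff m = Polynomial.X ^ w := by
  have h1 : (S.kappa (S.x ^ (m - (w + 1) / 2))).natDegree ≤ m - (w + 1) / 2 := by simp
  have hy : (S.kappa S.y).natDegree ≤ 1 := by rw [kappa_y]; compute_degree
  have hz : (S.kappa S.z).natDegree ≤ 1 := by rw [kappa_z]; compute_degree
  have h2 : (S.kappa (S.y ^ (w / 2))).natDegree ≤ w / 2 := by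
    rw [map_pow]; exact (Polynomial.natDegree_pow_le_of_le _ hy).trans (by simp)
  have h3 : (S.kappa (S.z ^ (w % 2))).natDegree ≤ w % 2 := by
    rw [map_pow]; exact (Polynomial.natDegree_pow_le_of_le _ hz).trans (by simp)
  have h4 : (S.kappa (S.y ^ (w / 2)) * S.kappa (S.z ^ (w % 2))).natDegree ≤ w / 2 + w % 2 :=
    Polynomial.natDegree_mul_le_of_le h2 h3
  have e2 : (S.kappa (S.y ^ (w / 2))).coeff (w / 2) = Polynomial.X ^ (2 * (w / 2)) := by
    have := Polynomial.coeff_pow_of_natDegree_le hy (m := w / 2)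
    rw [mul_one] at this
    rw [map_pow, this, kappa_y, pow_mul]
    congr 1
    rw [Polynomial.coeff_add, Polynomial.coeff_C_mul]
    simp [Polynomial.coeff_C]
  have e3 : (S.kappa (S.z ^ (w % 2))).coeff (w % 2) = Polynomial.X ^ (w % 2) := by
    have := Polynomial.coeff_pow_of_natDegree_le hz (m := w % 2)
    rw [mul_one] at this
    rw [map_pow, this, kappa_z]
    simp [Polynomial.coeff_one]
  rw [b, c, map_mul, map_mul]
  have key := Polynomial.coeff_mul_add_eq_of_natDegree_le h1 h4
  rw [Polynomial.coeff_mul_add_eq_of_natDegree_le h2 h3, e2, e3, ← pow_add,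
    show 2 * (w / 2) + w % 2 = w by omega,
    show (m - (w + 1) / 2) + (w / 2 + w % 2) = m by omega] at key
  rw [key]
  simp

theorem Sm_repr {m : ℕ} {s : B} (hs : s ∈ S.Sm m) :
    s = ∑ w ∈ Finset.range (2 * m + 1), ((S.kappa s).coeff m).coeff w • S.b m w := by
  induction hs using Submodule.span_induction with
  | mem v hv =>
    obtain ⟨w, hw, rfl⟩ := hv
    simp only [Set.mem_ofPred_eq] at hw
    rw [S.kappa_b hw]
    simp [Polynomial.coeff_X_pow, hw]
  | zero => simp
  | add a b _ _ ha hb =>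
    simp only [map_add, Polynomial.coeff_add, add_smul, Finset.sum_add_distrib]
    rw [← ha, ← hb]
  | smul a v _ h =>
    simp only [map_smul, Polynomial.coeff_smul, smul_assoc, ← Finset.smul_sum]
    rw [← h]

theorem V_drop {m : ℕ} {f : B} (hf : f ∈ S.V ^ (m + 1)) (h0 : (S.kappa f).coeff (m + 1) = 0) :
    f ∈ S.V ^ m := by
  obtain ⟨s, hs, g, hg, rfl⟩ := Submodule.mem_sup.1 (S.V_pow_le m hf)
  have h1 : (S.kappa g).coeff (m + 1) = 0 :=
    Polynomial.coeff_eq_zero_of_natDegree_lt (Nat.lt_succ_of_le (S.kappa_natDegree hg))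
  have h2 : (S.kappa s).coeff (m + 1) = 0 := by simpa [h1] using h0
  have := S.Sm_repr hs
  rw [h2] at this
  simp at this
  rw [this, zero_add]; exact hg

theorem mem_V_of_kappa (f : B) : f ∈ S.V ^ (S.kappa f).natDegree := by
  obtain ⟨m, hm⟩ := S.exists_V f
  induction m with
  | zero => exact S.V_mono (Nat.zero_le _) hm
  | succ m ih =>
    by_cases h : (S.kappa f).coeff (m + 1) = 0
    · exact ih (S.V_drop hm h)
    · exact S.V_mono (Polynomial.le_natDegree_of_ne_zero h) hm

theorem V_zero {f : B} (hf : f ∈ S.V ^ 0) : ∃ a : ℂ, f = algebraMap ℂ B a := by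
  rw [pow_zero] at hf
  obtain ⟨a, ha⟩ := Submodule.mem_one.1 hf
  exact ⟨a, ha.symm⟩

theorem exists_repr (f : B) : ∃ A : R2, f = A.sum fun w a => Polynomial.aeval S.x a * S.c w := by
  have hadd : ∀ f g : B, (∃ A : R2, f = A.sum fun w a => Polynomial.aeval S.x a * S.c w) →
      (∃ A : R2, g = A.sum fun w a => Polynomial.aeval S.x a * S.c w) →
      (∃ A : R2, f + g = A.sum fun w a => Polynomial.aeval S.x a * S.c w) := by
    rintro f g ⟨A, rfl⟩ ⟨A', rfl⟩
    refine ⟨A + A', ?_⟩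
    rw [Polynomial.sum_add_index]
    · simp
    · intros; simp [add_mul]
  have hSm : ∀ m, ∀ f ∈ S.Sm m, ∃ A : R2, f = A.sum fun w a => Polynomial.aeval S.x a * S.c w := by
    intro m f hf
    induction hf using Submodule.span_induction with
    | mem v hv =>
      obtain ⟨w, hw, rfl⟩ := hv
      refine ⟨Polynomial.monomial w (Polynomial.X ^ (m - (w + 1) / 2)), ?_⟩
      rw [Polynomial.sum_monomial_index _ _ (by simp)]
      simp [b]
    | zero => exact ⟨0, by simp⟩
    | add a b _ _ ha hb => exact hadd _ _ ha hb
    | smul a v _ h =>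
      obtain ⟨A, rfl⟩ := h
      refine ⟨(Polynomial.C a : R1) • A, ?_⟩
      rw [Polynomial.sum_smul_index _ _ _ (by simp)]
      simp [Polynomial.sum, Finset.mul_sum, Algebra.smul_def, mul_assoc]
  have hV : ∀ m, ∀ f ∈ S.V ^ m, ∃ A : R2, f = A.sum fun w a => Polynomial.aeval S.x a * S.c w := by
    intro m
    induction m with
    | zero =>
      intro f hf
      obtain ⟨a, rfl⟩ := S.V_zero hf
      refine ⟨Polynomial.C (Polynomial.C a), ?_⟩
      rw [Polynomial.sum_C_index] <;> simp [c]
    | succ m ih =>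
      intro f hf
      obtain ⟨s, hs, g, hg, rfl⟩ := Submodule.mem_sup.1 (S.V_pow_le m hf)
      exact hadd _ _ (hSm _ s hs) (ih g hg)
  obtain ⟨m, hm⟩ := S.exists_V f
  exact hV m f hm

theorem exists_Q {f : B} (hf : f ≠ 0) : ∃ Q : R2, Q ≠ 0 ∧
    S.x ^ (Q.natDegree / 2) * f = ev S.x S.z Q := by
  obtain ⟨A, hA⟩ := S.exists_repr f
  have hA0 : A ≠ 0 := by rintro rfl; simp at hA; exact hf hA
  set N := A.natDegree with hN
  let q : ℕ → R2 := fun w => (Polynomial.X ^ 2 - 1) ^ (w / 2) * Polynomial.X ^ (w % 2)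
  have hmon : ∀ w, (q w).Monic := fun w => by
    apply Polynomial.Monic.mul _ (Polynomial.monic_X_pow _)
    apply Polynomial.Monic.pow
    have := Polynomial.monic_X_pow_sub_C (1 : R1) (n := 2) (by norm_num)
    simpa using this
  have hdeg : ∀ w, (q w).natDegree = w := fun w => by
    have h1 : (Polynomial.X ^ 2 - 1 : R2).Monic := by
      have := Polynomial.monic_X_pow_sub_C (1 : R1) (n := 2) (by norm_num)
      simpa using this
    have h2 : (Polynomial.X ^ 2 - 1 : R2).natDegree = 2 := by
      have := Polynomial.natDegree_X_pow_sub_C (r := (1 : R1)) (n := 2)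
      simpa using this
    simp only [q]
    rw [Polynomial.Monic.natDegree_mul (h1.pow _) (Polynomial.monic_X_pow _), h1.natDegree_pow, h2,
      Polynomial.natDegree_X_pow]
    omega
  let Q : R2 := ∑ w ∈ Finset.range (N + 1),
    Polynomial.C (A.coeff w * Polynomial.X ^ (N / 2 - w / 2)) * q w
  have hQN : Q.coeff N = A.coeff N := by
    simp only [Q, Polynomial.finsetSum_coeff, Polynomial.coeff_C_mul]
    rw [Finset.sum_range_succ, Finset.sum_eq_zero]
    · have := (hmon N).coeff_natDegree
      rw [hdeg] at this
      simp [this]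
    · intro w hw
      rw [Polynomial.coeff_eq_zero_of_natDegree_lt (p := q w), mul_zero]
      rw [hdeg]; exact Finset.mem_range.1 hw
  have hle : Q.natDegree ≤ N := by
    apply Polynomial.natDegree_sum_le_of_forall_le
    intro w hw
    refine (Polynomial.natDegree_C_mul_le _ _).trans ?_
    rw [hdeg]; exact Nat.lt_succ_iff.1 (Finset.mem_range.1 hw)
  have hne : Q.coeff N ≠ 0 := by
    rw [hQN, hN, Polynomial.coeff_natDegree]; simpa using hA0
  have hQd : Q.natDegree = N := le_antisymm hle (Polynomial.le_natDegree_of_ne_zero hne)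
  refine ⟨Q, by rintro h; rw [h] at hne; simp at hne, ?_⟩
  rw [hQd, hA, Polynomial.sum_over_range _ (by simp), Finset.mul_sum]
  simp only [Q, ev, Polynomial.eval₂_finsetSum]
  refine Finset.sum_congr rfl fun w hw => ?_
  have hw' : w ≤ N := Nat.lt_succ_iff.1 (Finset.mem_range.1 hw)
  have hxy : (S.z ^ 2 - 1) ^ (w / 2) = S.x ^ (w / 2) * S.y ^ (w / 2) := by
    rw [← mul_pow, S.rel]
  simp only [q, Polynomial.eval₂_mul, Polynomial.eval₂_C, Polynomial.eval₂_pow,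
    Polynomial.eval₂_sub, Polynomial.eval₂_X, Polynomial.eval₂_one, hxy, c]
  have : S.x ^ (N / 2) = S.x ^ (N / 2 - w / 2) * S.x ^ (w / 2) := by
    rw [← pow_add]; congr 1; omega
  simp [this]; ring

theorem d_of_Q {f : B} {Q : R2} {k : ℕ} (h : S.x ^ k * f = ev S.x S.z Q) :
    S.d f = Q.natDegree := by
  have h1 := congrArg S.iota h
  rw [map_ev, iota_x, iota_z, ev_CX, map_mul, map_pow, iota_x, ← map_pow] at h1
  have h2 := congrArg Polynomial.natDegree h1
  rw [Polynomial.natDegree_C_mul (pow_ne_zero _ Polynomial.X_ne_zero), Polynomial.natDegree_comp] at h2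
  have h3 : (1 + Polynomial.C Polynomial.X * Polynomial.X : R2).natDegree = 1 := by
    rw [add_comm]
    have := Polynomial.natDegree_linear (a := (Polynomial.X : R1)) (b := 1) Polynomial.X_ne_zero
    simpa using this
  rw [h3, mul_one] at h2
  exact h2

theorem iota_injective : Function.Injective S.iota := by
  rw [injective_iff_map_eq_zero]
  intro f hf
  by_contra hne
  obtain ⟨Q, hQ, h⟩ := S.exists_Q hne
  have h1 := congrArg S.iota h
  rw [map_ev, iota_x, iota_z, ev_CX, map_mul, hf, mul_zero, eq_comm,
    Polynomial.comp_eq_zero_iff] at h1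
  rcases h1 with h1 | ⟨_, h1⟩
  · exact hQ h1
  · have := congrArg (Polynomial.coeff · 1) h1
    simp [Polynomial.coeff_one, Polynomial.coeff_C] at this

theorem isDomain (S : Quad B) : IsDomain B := Function.Injective.isDomain (S.iota : B →+* R2) S.iota_injective

end Quad
end QF

namespace QF

theorem ev_eq_sum {R : Type} [CommRing R] [Algebra ℂ R] (x z : R) (Q : R2) :
    ev x z Q = Q.sum fun j q => q.sum fun i c => c • (x ^ i * z ^ j) := by
  unfold ev
  rw [Polynomial.eval₂_eq_sum]
  refine Finset.sum_congr rfl fun j _ => ?_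
  simp only [AlgHom.toRingHom_eq_coe, RingHom.coe_coe, Polynomial.aeval_eq_sum_range]
  rw [Polynomial.sum_over_range _ (by simp), Finset.sum_mul]
  simp

/-- the form of weight `W` -/
noncomputable def lf {R : Type} [CommRing R] [Algebra ℂ R] (n M : ℕ) (Q : R2) (W : ℕ) (a b : R) : R :=
  Q.sum fun j q => q.sum fun i c => if n * i + M * j = W then c • (a ^ i * b ^ j) else 0

theorem map_lf {R R' : Type} [CommRing R] [Algebra ℂ R] [CommRing R'] [Algebra ℂ R']
    (n M : ℕ) (Q : R2) (W : ℕ) (a b : R) (g : R →ₐ[ℂ] R') :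
    g (lf n M Q W a b) = lf n M Q W (g a) (g b) := by
  simp only [lf, Polynomial.sum, map_sum]
  refine Finset.sum_congr rfl fun j _ => Finset.sum_congr rfl fun i _ => ?_
  split_ifs <;> simp

theorem lf_coeff {R : Type} [CommRing R] [Algebra ℂ R] (n M : ℕ) (Q : R2) (W : ℕ) (a : R) (j : ℕ) :
    (lf n M Q W (Polynomial.C a) Polynomial.X).coeff j =
      (Q.coeff j).sum fun i c => if n * i + M * j = W then c • a ^ i else 0 := by
  simp only [lf, Polynomial.sum, Polynomial.finsetSum_coeff]
  rw [Finset.sum_eq_single j]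
  · refine Finset.sum_congr rfl fun i _ => ?_
    split_ifs
    · rw [Polynomial.coeff_smul, ← map_pow, Polynomial.coeff_C_mul_X_pow, if_pos rfl]
    · simp
  · intro k _ hk
    refine Finset.sum_eq_zero fun i _ => ?_
    split_ifs
    · rw [Polynomial.coeff_smul, ← map_pow, Polynomial.coeff_C_mul_X_pow, if_neg (Ne.symm hk),
        smul_zero]
    · simp
  · intro h
    simp at h
    simp [h]

theorem lf_natDegree {R : Type} [CommRing R] [Algebra ℂ R] (n M : ℕ) (Q : R2) (W : ℕ) (a : R) :
    (lf n M Q W (Polynomial.C a) Polynomial.X).natDegree ≤ Q.natDegree := by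
  rw [Polynomial.natDegree_le_iff_coeff_eq_zero]
  intro k hk
  rw [lf_coeff, Polynomial.coeff_eq_zero_of_natDegree_lt hk]; simp

theorem lf_derivative {R : Type} [CommRing R] [Algebra ℂ R] (n M : ℕ) (Q : R2) (W : ℕ) (a : R) :
    Polynomial.derivative (lf n M Q (W + M) (Polynomial.C a) Polynomial.X) =
      lf n M (Polynomial.derivative Q) W (Polynomial.C a) Polynomial.X := by
  ext j
  rw [Polynomial.coeff_derivative, lf_coeff, lf_coeff, Polynomial.coeff_derivative]
  have : Q.coeff (j + 1) * ((j : R1) + 1) = ((j : ℂ) + 1) • Q.coeff (j + 1) := by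
    rw [Polynomial.smul_eq_C_mul, mul_comm]; simp
  rw [this, Polynomial.sum_smul_index _ _ _ (by simp)]
  simp only [Polynomial.sum, Finset.sum_mul]
  refine Finset.sum_congr rfl fun i _ => ?_
  have : n * i + M * (j + 1) = W + M ↔ n * i + M * j = W := by rw [mul_add]; omega
  simp only [this]
  split_ifs
  · simp only [Algebra.smul_def, map_mul, map_add, map_natCast, map_one]; ring
  · simp

theorem lf_iterate {R : Type} [CommRing R] [Algebra ℂ R] (n M : ℕ) (Q : R2) (W r : ℕ) (a : R) :
    Polynomial.derivative^[r] (lf n M Q (W + r * M) (Polynomial.C a) Polynomial.X) =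
      lf n M (Polynomial.derivative^[r] Q) W (Polynomial.C a) Polynomial.X := by
  induction r generalizing Q with
  | zero => simp
  | succ r ih =>
    rw [Function.iterate_succ_apply, Function.iterate_succ_apply, ← ih, ← lf_derivative,
      show W + (r + 1) * M = W + r * M + M by ring]

/-- support bound -/
def WB (n M : ℕ) (Q : R2) (W : ℕ) : Prop := ∀ i j, (Q.coeff j).coeff i ≠ 0 → n * i + M * j ≤ W

theorem WB_derivative {n M : ℕ} {Q : R2} {W : ℕ} (h : WB n M Q (W + M)) :
    WB n M (Polynomial.derivative Q) W := by
  intro i j hij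
  have := h i (j + 1) (by
    intro h0
    apply hij
    rw [Polynomial.coeff_derivative]
    have : ((j : R1) + 1) = Polynomial.C ((j : ℂ) + 1) := by simp
    rw [this, Polynomial.coeff_mul_C, h0, zero_mul])
  rw [mul_add] at this; omega

theorem WB_iterate {n M : ℕ} {Q : R2} {W r : ℕ} (h : WB n M Q (W + r * M)) :
    WB n M (Polynomial.derivative^[r] Q) W := by
  induction r generalizing Q with
  | zero => simpa using h
  | succ r ih =>
    rw [Function.iterate_succ_apply]
    apply ih
    apply WB_derivative
    convert h using 1; ring

theorem ev_coeff {n M : ℕ} {Q : R2} {W : ℕ} (h : WB n M Q W) {X Z : R2} (hX : X.natDegree ≤ n)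
    (hZ : Z.natDegree ≤ M) : (ev X Z Q).coeff W = lf n M Q W (X.coeff n) (Z.coeff M) := by
  rw [ev_eq_sum]
  simp only [lf, Polynomial.sum, Polynomial.finsetSum_coeff]
  refine Finset.sum_congr rfl fun j _ => Finset.sum_congr rfl fun i hi => ?_
  have h1 : (X ^ i).natDegree ≤ n * i := by
    have := Polynomial.natDegree_pow_le_of_le i hX; rwa [mul_comm] at this
  have h2 : (Z ^ j).natDegree ≤ M * j := by
    have := Polynomial.natDegree_pow_le_of_le j hZ; rwa [mul_comm] at this
  rw [Polynomial.coeff_smul]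
  split_ifs with hW
  · rw [← hW, Polynomial.coeff_mul_add_eq_of_natDegree_le h1 h2, mul_comm n, mul_comm M,
      Polynomial.coeff_pow_of_natDegree_le hX, Polynomial.coeff_pow_of_natDegree_le hZ]
  · have := h i j (by simpa using hi)
    rw [Polynomial.coeff_eq_zero_of_natDegree_lt (p := X ^ i * Z ^ j), smul_zero]
    exact (Polynomial.natDegree_mul_le_of_le h1 h2).trans_lt (lt_of_le_of_ne this hW)

theorem exists_W {n M : ℕ} {Q : R2} (hQ : Q ≠ 0) : ∃ W, WB n M Q W ∧ M * Q.natDegree ≤ W ∧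
    ∃ i j, (Q.coeff j).coeff i ≠ 0 ∧ n * i + M * j = W := by
  classical
  let s : Finset (ℕ × ℕ) := Q.support.biUnion fun j => (Q.coeff j).support.image fun i => (i, j)
  have hs : ∀ i j, (i, j) ∈ s ↔ (Q.coeff j).coeff i ≠ 0 := by
    intro i j
    simp only [s, Finset.mem_biUnion, Finset.mem_image, Polynomial.mem_support_iff, Prod.mk.injEq]
    constructor
    · rintro ⟨j', _, i', h, rfl, rfl⟩; exact h
    · intro h; exact ⟨j, by rintro h0; simp [h0] at h, i, h, rfl, rfl⟩
  have hlead : Q.coeff Q.natDegree ≠ 0 := by simpa using hQ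
  have hmem : ((Q.coeff Q.natDegree).natDegree, Q.natDegree) ∈ s := by
    rw [hs]; rw [Polynomial.coeff_natDegree (p := Q.coeff Q.natDegree)]; simpa using hQ
  obtain ⟨⟨i, j⟩, hij, hmax⟩ := Finset.exists_max_image s (fun p => n * p.1 + M * p.2) ⟨_, hmem⟩
  refine ⟨n * i + M * j, fun i' j' h => hmax (i', j') ((hs _ _).2 h), ?_, i, j, (hs _ _).1 hij, rfl⟩
  have := hmax _ hmem
  simp only at this
  omega

theorem lf_ne_zero {R : Type} [CommRing R] [IsDomain R] [Algebra ℂ R] {n M : ℕ} {Q : R2} {W : ℕ} {a : R} (hn : 0 < n)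
    (ha : a ≠ 0) (h : ∃ i j, (Q.coeff j).coeff i ≠ 0 ∧ n * i + M * j = W) :
    lf n M Q W (Polynomial.C a) Polynomial.X ≠ 0 := by
  obtain ⟨i, j, hij, hW⟩ := h
  intro h0
  have := congrArg (Polynomial.coeff · j) h0
  simp only [lf_coeff, Polynomial.coeff_zero, Polynomial.sum] at this
  rw [Finset.sum_eq_single i, if_pos hW, smul_eq_zero] at this
  · rcases this with h | h
    · exact hij h
    · exact pow_ne_zero _ ha h
  · intro k _ hk
    rw [if_neg]
    intro h
    have : n * k = n * i := by omega
    exact hk (Nat.eq_of_mul_eq_mul_left hn this)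
  · intro h; simp at h; exact absurd h hij

theorem count_add_le {α : Type} [DecidableEq α] (s : Multiset α) {a b : α} (h : a ≠ b) :
    s.count a + s.count b ≤ s.card := by
  induction s using Multiset.induction_on with
  | empty => simp
  | cons c s ih =>
    simp only [Multiset.count_cons, Multiset.card_cons]
    split_ifs with h1 h2
    · exact absurd (h1.trans h2.symm) h
    · omega
    · omega
    · omega

theorem mult_bound {f : R2} (hf : f ≠ 0) {b b' : R1} (hb : b ≠ b') {r : ℕ}
    (h1 : (Polynomial.X - Polynomial.C b) ^ r ∣ f) (h2 : (Polynomial.X - Polynomial.C b') ^ r ∣ f) :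
    2 * r ≤ f.natDegree := by
  classical
  have h := count_add_le f.roots hb
  rw [Polynomial.count_roots, Polynomial.count_roots] at h
  have e1 := (Polynomial.le_rootMultiplicity_iff hf).2 h1
  have e2 := (Polynomial.le_rootMultiplicity_iff hf).2 h2
  have := f.card_roots'
  omega

/-- non-divisible case -/
theorem mult_case1 {n M : ℕ} {Q : R2} {W : ℕ} {a b : R1} (hn : 0 < n) (hM : ¬ n ∣ M) (hb : b ≠ 0)
    (hf : lf n M Q W (Polynomial.C a) Polynomial.X ≠ 0) {r : ℕ}
    (h1 : (Polynomial.X - Polynomial.C b) ^ r ∣ lf n M Q W (Polynomial.C a) Polynomial.X) :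
    2 * r ≤ Q.natDegree := by
  have hn0 : (n : ℂ) ≠ 0 := by exact_mod_cast hn.ne'
  set ω := Complex.exp (2 * Real.pi * Complex.I / n) with hω
  have hprim : IsPrimitiveRoot ω n := Complex.isPrimitiveRoot_exp n hn.ne'
  have hω0 : ω ≠ 0 := Complex.exp_ne_zero _
  have hζ1 : ω ^ M ≠ 1 := fun h => hM (hprim.dvd_of_pow_eq_one M h)
  have hζ0 : ω ^ M ≠ 0 := pow_ne_zero _ hω0
  set f := lf n M Q W (Polynomial.C a) Polynomial.X with hfdef
  have hcomp : f.comp (Polynomial.C (Polynomial.C (ω ^ M)) * Polynomial.X) = (ω ^ W) • f := by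
    have e := map_lf n M Q W (Polynomial.C a : R2) Polynomial.X
      ((Polynomial.aeval (R := R1) (Polynomial.C (Polynomial.C (ω ^ M)) * Polynomial.X : R2)).restrictScalars ℂ)
    simp only [AlgHom.restrictScalars_apply, ← hfdef] at e
    have e' : f.comp (Polynomial.C (Polynomial.C (ω ^ M)) * Polynomial.X) =
      (Polynomial.aeval (R := R1) (Polynomial.C (Polynomial.C (ω ^ M)) * Polynomial.X : R2)) f := by
      simp [Polynomial.comp, Polynomial.aeval_def, Polynomial.algebraMap_eq]
    rw [e', e, Polynomial.aeval_C, Polynomial.aeval_X, hfdef]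
    simp only [lf, Polynomial.sum, Finset.smul_sum, Polynomial.algebraMap_eq]
    refine Finset.sum_congr rfl fun j _ => Finset.sum_congr rfl fun i _ => ?_
    split_ifs with h
    · have : (Polynomial.C (Polynomial.C (ω ^ M)) * Polynomial.X : R2) ^ j =
        (ω ^ W) • Polynomial.X ^ j := by
        rw [mul_pow, ← map_pow, ← map_pow, ← pow_mul, ← h, pow_add, pow_mul ω n i, hprim.pow_eq_one,
          one_pow, one_mul, Algebra.smul_def]
        simp [Polynomial.algebraMap_apply]
      rw [this, mul_smul_comm, smul_comm]
    · simp
  obtain ⟨g, hg⟩ := h1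
  set b' : R1 := Polynomial.C (ω ^ M)⁻¹ * b with hb'
  have hCC : (Polynomial.C (ω ^ M) : R1) * Polynomial.C (ω ^ M)⁻¹ = 1 := by
    rw [← map_mul, mul_inv_cancel₀ hζ0, map_one]
  have hdvd : (Polynomial.X - Polynomial.C b') ^ r ∣ f := by
    have h3 := hcomp
    rw [hg, Polynomial.mul_comp, Polynomial.pow_comp, Polynomial.sub_comp, Polynomial.X_comp,
      Polynomial.C_comp, ← hg] at h3
    have h4 : (Polynomial.C (Polynomial.C (ω ^ M)) * Polynomial.X - Polynomial.C b : R2) =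
      Polynomial.C (Polynomial.C (ω ^ M)) * (Polynomial.X - Polynomial.C b') := by
      rw [mul_sub, ← map_mul, hb', ← mul_assoc, hCC, one_mul]
    rw [h4, mul_pow] at h3
    have h5 : f = (ω ^ W)⁻¹ • ((ω ^ W) • f) := by
      rw [smul_smul, inv_mul_cancel₀ (pow_ne_zero _ hω0), one_smul]
    rw [h5, ← h3]
    refine Dvd.dvd.trans ?_ (dvd_smul_of_dvd _ (dvd_refl _))
    exact (Dvd.intro_left _ rfl).mul_right _
  refine (mult_bound hf (b' := b') ?_ ⟨g, hg⟩ hdvd).trans (lf_natDegree _ _ _ _ _)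
  intro h
  rw [hb'] at h
  have : (Polynomial.C (ω ^ M)⁻¹ : R1) = 1 := by
    have h' : (1 : R1) * b = Polynomial.C (ω ^ M)⁻¹ * b := by rw [one_mul]; exact h
    exact (mul_right_cancel₀ hb h').symm
  rw [← map_one Polynomial.C] at this
  exact hζ1 (inv_eq_one.1 (Polynomial.C_injective this))

theorem mult_case2 {K : Type} [Field K] [Algebra R1 K] [IsFractionRing R1 K] [Algebra ℂ K]
    [IsScalarTower ℂ R1 K] {n e : ℕ} {Q : R2} {W : ℕ} {a b : R1} (hn : 0 < n) (ha : a ≠ 0)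
    (hex : ∃ i j, (Q.coeff j).coeff i ≠ 0 ∧ n * i + (n * e) * j = W)
    (h0 : lf n (n * e) Q W a b = 0) : ∃ c : ℂ, b = c • a ^ e := by
  have hinj : Function.Injective (algebraMap R1 K) := IsFractionRing.injective R1 K
  set A : K := algebraMap R1 K a with hA
  have hA0 : A ≠ 0 := by rwa [hA, Ne, map_eq_zero_iff _ hinj]
  set u : K := algebraMap R1 K b / A ^ e with hu
  have hbu : algebraMap R1 K b = u * A ^ e := by rw [hu]; field_simp
  have hp := lf_ne_zero (R := ℂ) (a := 1) hn one_ne_zero hex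
  set p := lf n (n * e) Q W (Polynomial.C (1 : ℂ)) Polynomial.X with hpdef
  obtain ⟨i0, j0, _, hW⟩ := hex
  have e1 : algebraMap R1 K (lf n (n * e) Q W a b) = A ^ (i0 + e * j0) * Polynomial.aeval u p := by
    have := map_lf n (n * e) Q W a b (IsScalarTower.toAlgHom ℂ R1 K)
    rw [IsScalarTower.coe_toAlgHom'] at this
    rw [this, hpdef, map_lf, hbu]
    simp only [lf, Polynomial.sum, Finset.mul_sum, map_one, Polynomial.aeval_X]
    refine Finset.sum_congr rfl fun j _ => Finset.sum_congr rfl fun i _ => ?_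
    split_ifs with h
    · have : i0 + e * j0 = i + e * j := by
        apply Nat.eq_of_mul_eq_mul_left hn
        rw [mul_add, mul_add, ← mul_assoc, ← mul_assoc]; omega
      rw [this, mul_smul_comm, mul_pow, ← pow_mul, one_pow, one_mul, pow_add]
      congr 1; ring
    · simp
  rw [h0, map_zero, eq_comm, mul_eq_zero] at e1
  have hroot : Polynomial.aeval u p = 0 := e1.resolve_left (pow_ne_zero _ hA0)
  have halg : IsIntegral ℂ u := (IsAlgebraic.isIntegral ⟨p, hp, hroot⟩)
  obtain ⟨c, hc⟩ := minpoly.mem_range_of_degree_eq_one ℂ u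
    (IsAlgClosed.degree_eq_one_of_irreducible ℂ (minpoly.irreducible halg))
  refine ⟨c, hinj ?_⟩
  rw [hbu, ← hc, Algebra.smul_def, map_mul, map_pow, ← IsScalarTower.algebraMap_apply]

/-- SU0 -/
theorem SU0 {n M : ℕ} (hn : 0 < n) {Q X Z : R2} (hQ : Q ≠ 0) (hX : X.natDegree = n)
    (hZ : Z.natDegree = M) (hZ0 : Z ≠ 0) :
    (∃ e, M = n * e ∧ ∃ c : ℂ, Z.leadingCoeff = c • X.leadingCoeff ^ e) ∨
    ∃ r, 2 * r ≤ Q.natDegree ∧ ev X Z (Polynomial.derivative^[r] Q) ≠ 0 ∧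
      M * (Q.natDegree - r) ≤ (ev X Z (Polynomial.derivative^[r] Q)).natDegree := by
  obtain ⟨W, hWB, hMW, hex⟩ := exists_W (n := n) (M := M) hQ
  have hX0 : X ≠ 0 := by rintro rfl; simp at hX; omega
  set a := X.leadingCoeff with ha
  set b := Z.leadingCoeff with hb
  have ha0 : a ≠ 0 := by simpa [ha] using hX0
  have hb0 : b ≠ 0 := by simpa [hb] using hZ0
  have hf := lf_ne_zero (a := a) hn ha0 hex
  set f := lf n M Q W (Polynomial.C a) Polynomial.X with hfdef
  have hfb : f.eval b = lf n M Q W a b := by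
    have := map_lf n M Q W (Polynomial.C a : R2) Polynomial.X
      ((Polynomial.aeval (R := R1) b).restrictScalars ℂ)
    simpa [Polynomial.aeval_def, ← Polynomial.eval₂_eq_eval_map] using this
  set r := f.rootMultiplicity b with hr
  have hdvd : (Polynomial.X - Polynomial.C b) ^ r ∣ f := Polynomial.pow_rootMultiplicity_dvd _ _
  have key : 2 * r ≤ Q.natDegree → ∃ r, 2 * r ≤ Q.natDegree ∧ ev X Z (Polynomial.derivative^[r] Q) ≠ 0 ∧
      M * (Q.natDegree - r) ≤ (ev X Z (Polynomial.derivative^[r] Q)).natDegree := by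
    intro h2
    have hrM : r * M ≤ W := by
      refine le_trans ?_ hMW
      rw [mul_comm]; exact Nat.mul_le_mul_left _ (by omega)
    obtain ⟨W', hW'⟩ := Nat.exists_eq_add_of_le' hrM
    rw [hW'] at hWB hMW hfdef
    have hc := ev_coeff (WB_iterate hWB) hX.le hZ.le
    have hl := map_lf n M (Polynomial.derivative^[r] Q) W' (Polynomial.C a : R2) Polynomial.X
      ((Polynomial.aeval (R := R1) b).restrictScalars ℂ)
    rw [← lf_iterate, ← hfdef] at hl
    simp only [AlgHom.restrictScalars_apply, Polynomial.aeval_C, Polynomial.aeval_X] at hl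
    have hev : (Polynomial.aeval b) (Polynomial.derivative^[r] f) ≠ 0 := by
      rw [Polynomial.coe_aeval_eq_eval, hr, Polynomial.eval_iterate_derivative_rootMultiplicity]
      rw [smul_ne_zero_iff]
      exact ⟨Nat.factorial_ne_zero _, Polynomial.eval_divByMonic_pow_rootMultiplicity_ne_zero _ hf⟩
    have hne : (ev X Z (Polynomial.derivative^[r] Q)).coeff W' ≠ 0 := by
      rw [hc]
      have : X.coeff n = a := by rw [ha, ← hX]; rfl
      rw [this]
      have : Z.coeff M = b := by rw [hb, ← hZ]; rfl
      rw [this]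
      rw [hl] at hev
      exact hev
    refine ⟨r, h2, fun h => hne (by rw [h]; simp), ?_⟩
    refine le_trans ?_ (Polynomial.le_natDegree_of_ne_zero hne)
    rw [Nat.mul_sub]
    rw [mul_comm M r]; omega
  by_cases hM : n ∣ M
  · obtain ⟨e, rfl⟩ := hM
    by_cases h0 : f.eval b = 0
    · rw [hfb] at h0
      exact Or.inl ⟨e, rfl, mult_case2 (K := FractionRing R1) hn ha0 hex h0⟩
    · right
      apply key
      have : r = 0 := Polynomial.rootMultiplicity_eq_zero h0
      omega
  · exact Or.inr (key (mult_case1 hn hM hb0 hf hdvd))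

end QF

namespace QF

noncomputable def dT : Derivation ℂ R2 R2 :=
  PolynomialModule.equivPolynomialSelf.compDer
    (Polynomial.derivative' : Derivation ℂ R1 R1).mapCoeffs

theorem dT_coeff (g : R2) (i : ℕ) : (dT g).coeff i = Polynomial.derivative (g.coeff i) := rfl

noncomputable def dt : Derivation ℂ R2 R2 :=
  (Polynomial.derivative' : Derivation R1 R2 R2).restrictScalars ℂ

theorem dt_apply (g : R2) : dt g = Polynomial.derivative g := rfl

theorem dT_natDegree (g : R2) : (dT g).natDegree ≤ g.natDegree := by
  rw [Polynomial.natDegree_le_iff_coeff_eq_zero]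
  intro k hk
  rw [dT_coeff, Polynomial.coeff_eq_zero_of_natDegree_lt hk, map_zero]

noncomputable def DD (X : R2) : Derivation ℂ R2 R2 := dT X • dt - dt X • dT

theorem DD_apply (X g : R2) : DD X g = dT X * dt g - dt X * dT g := by
  simp [DD]

theorem DD_natDegree {X : R2} (hX : 0 < X.natDegree) (g : R2) :
    (DD X g).natDegree ≤ g.natDegree + X.natDegree - 1 := by
  rw [DD_apply, dt_apply, dt_apply]
  refine (Polynomial.natDegree_sub_le _ _).trans (max_le ?_ ?_)
  · by_cases hg : g.natDegree = 0
    · have : Polynomial.derivative g = 0 := Polynomial.derivative_of_natDegree_zero hg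
      rw [this]; simp
    · have h1 := Polynomial.natDegree_mul_le_of_le (dT_natDegree X)
        (Polynomial.natDegree_derivative_le g)
      omega
  · have h1 := Polynomial.natDegree_mul_le_of_le (Polynomial.natDegree_derivative_le X)
      (dT_natDegree g)
    omega

theorem der_ev {R : Type} [CommRing R] [Algebra ℂ R] (D : Derivation ℂ R R) {x : R} (hx : D x = 0)
    (z : R) (Q : R2) : D (ev x z Q) = ev x z (Polynomial.derivative Q) * D z := by
  have hp : ∀ p : R1, D (Polynomial.aeval x p) = 0 := by
    intro p
    rw [Polynomial.aeval_eq_sum_range, map_sum]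
    refine Finset.sum_eq_zero fun i _ => ?_
    rw [Derivation.map_smul, Derivation.leibniz_pow, hx]; simp
  induction Q using Polynomial.induction_on' with
  | add p q hp hq =>
    unfold ev at *
    rw [Polynomial.eval₂_add, map_add, hp, hq, map_add, Polynomial.eval₂_add]; ring
  | monomial k a =>
    unfold ev
    rw [Polynomial.eval₂_monomial, Polynomial.derivative_monomial, Polynomial.eval₂_monomial,
      Derivation.leibniz]
    simp only [AlgHom.toRingHom_eq_coe, RingHom.coe_coe, hp, Derivation.leibniz_pow]
    simp; ring

theorem DT_ne {X : R2} (hX : 0 < X.natDegree) : DD X (Polynomial.C Polynomial.X) ≠ 0 := by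
  rw [DD_apply, dt_apply, dt_apply]
  have h1 : dT (Polynomial.C Polynomial.X) = 1 := by
    ext i : 1
    rw [dT_coeff, Polynomial.coeff_C, Polynomial.coeff_one]
    split_ifs <;> simp
  rw [h1]
  simp only [Polynomial.derivative_C, mul_zero, zero_sub, mul_one, ne_eq, neg_eq_zero]
  intro h
  have := Polynomial.derivative_eq_zero.1 h
  omega

theorem arith1 {n M r : ℕ} (hn : 0 < n) (hM : n ≤ M) (hr : 2 * r ≤ n)
    (h : M * (n - r) + r ≤ n * (n / 2)) : False := by
  have h1 : n * (n - r) ≤ M * (n - r) := Nat.mul_le_mul_right _ hM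
  have h2 : n * (n / 2) ≤ n * (n - r) := Nat.mul_le_mul_left _ (by omega)
  have h3 : r = 0 := by omega
  subst h3
  have h4 : n * (n - 0) ≤ n * (n / 2) := by omega
  have := Nat.le_of_mul_le_mul_left h4 hn
  omega

namespace Quad
variable {B : Type} [CommRing B] [Algebra ℂ B] (S : Quad B)

theorem L3 (j : B →ₐ[ℂ] R2) (w : B) (hw : j w = Polynomial.C Polynomial.X)
    (hn : 0 < (j S.x).natDegree) (hdw : S.d w = (j S.x).natDegree)
    (hM : (j S.x).natDegree ≤ (j S.z).natDegree) :
    ∃ p : R1, (j (S.z + S.x * Polynomial.aeval S.x p)).natDegree < (j S.z).natDegree := by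
  set X := j S.x with hX
  set Z := j S.z with hZ
  set Y := j S.y with hY
  have hrel : X * Y = Z ^ 2 - 1 := by
    have := congrArg j S.rel; simpa using this
  have hX0 : X ≠ 0 := by intro h; rw [h] at hn; simp at hn
  have hZ0 : Z ≠ 0 := by intro h; rw [h] at hM; simp at hM; omega
  have hw0 : w ≠ 0 := by rintro rfl; simp at hw; exact absurd hw.symm (by simp)
  obtain ⟨Q, hQ, hQe⟩ := S.exists_Q hw0
  have hN : Q.natDegree = X.natDegree := by rw [← hdw, S.d_of_Q hQe]
  have hev : X ^ (Q.natDegree / 2) * Polynomial.C Polynomial.X = ev X Z Q := by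
    have := congrArg j hQe
    rwa [map_ev, map_mul, map_pow, hw] at this
  set D := DD X with hD
  have hDX : D X = 0 := by rw [hD, DD_apply]; ring
  have hDev : D (ev X Z Q) ≠ 0 := by
    rw [← hev, Derivation.leibniz, Derivation.leibniz_pow, hDX]
    simp only [smul_eq_mul, mul_zero, nsmul_zero, smul_zero, add_zero]
    exact mul_ne_zero (pow_ne_zero _ hX0) (DT_ne hn)
  have hDZ0 : D Z ≠ 0 := by
    intro h; rw [der_ev D hDX, h, mul_zero] at hDev; exact hDev rfl
  have hdvd : X ∣ D Z := by
    have h1 := congrArg D hrel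
    have h1 : X * D Y = 2 * (Z * D Z) := by
      rw [Derivation.leibniz, hDX, map_sub, pow_two, Derivation.leibniz, Derivation.map_one_eq_zero] at h1
      simp only [smul_eq_mul, mul_zero, smul_zero, add_zero, sub_zero] at h1
      rw [h1]; ring
    refine ⟨Polynomial.C (Polynomial.C (1/2)) * (Z * D Y) - Y * D Z, ?_⟩
    have h2 : (Polynomial.C (Polynomial.C (1/2)) : R2) * 2 = 1 := by
      have : (2 : R2) = Polynomial.C (Polynomial.C 2) := by rw [map_ofNat, map_ofNat]
      rw [this, ← map_mul, ← map_mul]; norm_num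
    linear_combination (D Z) * hrel - (Polynomial.C (Polynomial.C (1/2)) * Z) * h1 - (Z^2 * D Z) * h2
  have hDZdeg : X.natDegree ≤ (D Z).natDegree := Polynomial.natDegree_le_of_dvd hdvd hDZ0
  have hstep : ∀ r, ev X Z (Polynomial.derivative^[r] Q) ≠ 0 →
      (ev X Z (Polynomial.derivative^[r] Q)).natDegree + r ≤ (ev X Z Q).natDegree := by
    intro r
    induction r with
    | zero => intro _; simp
    | succ r ih =>
      intro hne
      have h1 := der_ev D hDX Z (Polynomial.derivative^[r] Q)
      rw [← Function.iterate_succ_apply' (⇑Polynomial.derivative)] at h1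
      have h2 : D (ev X Z (Polynomial.derivative^[r] Q)) ≠ 0 := by
        rw [h1]; exact mul_ne_zero hne hDZ0
      have h3 : ev X Z (Polynomial.derivative^[r] Q) ≠ 0 := by
        intro h; rw [h] at h2; simp at h2
      have h4 := ih h3
      have h5 := DD_natDegree hn (ev X Z (Polynomial.derivative^[r] Q))
      rw [← hD, h1, Polynomial.natDegree_mul hne hDZ0] at h5
      omega
  have hdeg : (ev X Z Q).natDegree = X.natDegree * (X.natDegree / 2) := by
    rw [← hev, Polynomial.natDegree_mul_C (Polynomial.X_ne_zero), Polynomial.natDegree_pow, hN,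
      mul_comm]
  rcases SU0 hn hQ (X := X) (Z := Z) rfl rfl hZ0 with ⟨e, he, c, hc⟩ | ⟨r, hr, hne, hdr⟩
  · have he0 : e ≠ 0 := by rintro rfl; omega
    obtain ⟨e, rfl⟩ := Nat.exists_eq_succ_of_ne_zero he0
    refine ⟨-(Polynomial.C c * Polynomial.X ^ e), ?_⟩
    have h1 : j (S.z + S.x * Polynomial.aeval S.x (-(Polynomial.C c * Polynomial.X ^ e))) =
        Z - c • X ^ (e + 1) := by
      simp only [map_add, map_mul, map_neg, map_pow, Polynomial.aeval_C, Polynomial.aeval_X,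
        Algebra.smul_def, AlgHom.commutes, ← hX, ← hZ]; ring
    rw [h1]
    have hc0 : c ≠ 0 := by
      rintro rfl; rw [zero_smul] at hc; exact hZ0 (Polynomial.leadingCoeff_eq_zero.1 hc)
    have hsm : c • X ^ (e + 1) = Polynomial.C (Polynomial.C c) * X ^ (e + 1) := by
      rw [Algebra.smul_def]; simp [Polynomial.algebraMap_apply]
    have hCC : (Polynomial.C c : R1) ≠ 0 := by simpa using hc0
    have hd1 : (c • X ^ (e + 1)).natDegree = Z.natDegree := by
      rw [hsm, Polynomial.natDegree_C_mul hCC, Polynomial.natDegree_pow, he, mul_comm]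
    have hd0 : c • X ^ (e + 1) ≠ 0 := by
      rw [hsm]; exact mul_ne_zero (by simpa using hc0) (pow_ne_zero _ hX0)
    have hl : Z.leadingCoeff = (c • X ^ (e + 1)).leadingCoeff := by
      rw [hc, hsm, Polynomial.leadingCoeff_mul, Polynomial.leadingCoeff_pow, Polynomial.leadingCoeff_C,
        Polynomial.smul_eq_C_mul]
    have hlt := Polynomial.degree_sub_lt_left (p := Z) (q := c • X ^ (e + 1)) (by
      rw [Polynomial.degree_eq_natDegree hZ0, Polynomial.degree_eq_natDegree hd0, hd1]) hZ0 hl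
    by_cases hz : Z - c • X ^ (e + 1) = 0
    · rw [hz, Polynomial.natDegree_zero]; omega
    · exact Polynomial.natDegree_lt_natDegree hz hlt
  · exfalso
    have h1 := hstep r hne
    rw [hdeg] at h1
    rw [hN] at hdr hr
    exact arith1 hn hM hr (by omega)

theorem L3_cor (j : B →ₐ[ℂ] R2) (w : B) (hw : j w = Polynomial.C Polynomial.X)
    (hn : 0 < (j S.x).natDegree) (hdw : S.d w = (j S.x).natDegree) :
    ∃ p : R1, (j (S.z + S.x * Polynomial.aeval S.x p)).natDegree < (j S.x).natDegree := by
  classical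
  let P : ℕ → Prop := fun k => ∃ p : R1, (j (S.z + S.x * Polynomial.aeval S.x p)).natDegree = k
  have hP : ∃ k, P k := ⟨_, 0, rfl⟩
  obtain ⟨p, hp⟩ := Nat.find_spec hP
  by_contra! hcon
  have h1 := hcon p
  obtain ⟨q, hq⟩ := S.L3 (j.comp (S.tri p : B →ₐ[ℂ] B)) ((S.tri p).symm w) (by simpa using hw)
    (by simpa using hn) (by rw [d_tri_symm, hdw]; simp) (by simpa using h1)
  have h2 : (j.comp (S.tri p : B →ₐ[ℂ] B)) (S.z + S.x * Polynomial.aeval S.x q) =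
      j (S.z + S.x * Polynomial.aeval S.x (p + q)) := by
    simp only [AlgHom.comp_apply, AlgHom.coe_coe]
    congr 1
    rw [map_add, map_mul, ← Polynomial.aeval_algHom_apply]
    simp only [AlgEquiv.coe_algHom]
    rw [tri_x, tri_z, map_add]; ring
  have h3 : (j.comp (S.tri p : B →ₐ[ℂ] B)) S.z = j (S.z + S.x * Polynomial.aeval S.x p) := by simp
  rw [h2, h3, hp] at hq
  exact Nat.find_min hP hq ⟨_, rfl⟩

end Quad
end QF

namespace QF
namespace Quad
variable {B : Type} [CommRing B] [Algebra ℂ B] (S : Quad B)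

noncomputable def psi (a : ℂ) : B →ₐ[ℂ] R1 :=
  (Polynomial.mapAlgHom (Polynomial.aeval a : R1 →ₐ[ℂ] ℂ)).comp S.iota

theorem psi_apply (a : ℂ) (f : B) : S.psi a f = (S.iota f).map (Polynomial.evalRingHom a) := by
  simp only [psi, AlgHom.comp_apply, Polynomial.coe_mapAlgHom]
  rfl

theorem psi_x (a : ℂ) : S.psi a S.x = Polynomial.C a := by simp [psi_apply]
theorem psi_y (a : ℂ) : S.psi a S.y = 2 * Polynomial.X + Polynomial.C a * Polynomial.X ^ 2 := by
  simp [psi_apply]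
theorem psi_z (a : ℂ) : S.psi a S.z = 1 + Polynomial.C a * Polynomial.X := by simp [psi_apply]

noncomputable def sec (a : ℂ) : R1 →ₐ[ℂ] B := Polynomial.aeval (a⁻¹ • (S.z - 1))

theorem psi_sec {a : ℂ} (ha : a ≠ 0) (h : R1) : S.psi a (S.sec a h) = h := by
  have : (S.psi a).comp (S.sec a) = AlgHom.id ℂ R1 := by
    apply Polynomial.algHom_ext
    simp only [AlgHom.comp_apply, sec, Polynomial.aeval_X, map_smul, map_sub, psi_z, map_one,
      AlgHom.id_apply, add_sub_cancel_left, Polynomial.smul_eq_C_mul]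
    rw [← mul_assoc, ← map_mul, inv_mul_cancel₀ ha]; simp
  exact DFunLike.congr_fun this h

theorem psi_mod {a : ℂ} (ha : a ≠ 0) (f : B) :
    f - S.sec a (S.psi a f) ∈ Ideal.span {S.x - algebraMap ℂ B a} := by
  set I := Ideal.span {S.x - algebraMap ℂ B a} with hI
  have hx : Ideal.Quotient.mk I S.x = Ideal.Quotient.mk I (algebraMap ℂ B a) := by
    rw [Ideal.Quotient.eq]; exact Ideal.subset_span rfl
  have haa : algebraMap ℂ B a⁻¹ * algebraMap ℂ B a = 1 := by
    rw [← map_mul, inv_mul_cancel₀ ha, map_one]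
  have : Ideal.Quotient.mkₐ ℂ I = ((Ideal.Quotient.mkₐ ℂ I).comp (S.sec a)).comp (S.psi a) := by
    refine S.hom_ext ?_ ?_ ?_
    · simp only [AlgHom.comp_apply, psi_x, sec, Polynomial.aeval_C, Ideal.Quotient.mkₐ_eq_mk]
      exact hx
    · simp only [AlgHom.comp_apply, psi_y, sec, map_add, map_mul, map_pow, Polynomial.aeval_C,
        Polynomial.aeval_X, map_ofNat, Ideal.Quotient.mkₐ_eq_mk]
      have e : 2 * (a⁻¹ • (S.z - 1)) + algebraMap ℂ B a * (a⁻¹ • (S.z - 1)) ^ 2 =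
          algebraMap ℂ B a⁻¹ * (S.x * S.y) := by
        rw [S.rel, Algebra.smul_def]
        linear_combination (algebraMap ℂ B a⁻¹ * (S.z - 1) ^ 2) * haa
      have := congrArg (Ideal.Quotient.mk I) e
      rw [map_add, map_mul, map_mul, map_pow, map_mul, map_mul, hx, map_ofNat] at this
      rw [this, ← mul_assoc, ← map_mul, haa, map_one, one_mul]
    · simp only [AlgHom.comp_apply, psi_z, sec, map_add, map_mul, map_one, Polynomial.aeval_C,
        Polynomial.aeval_X]
      rw [← map_mul, Algebra.smul_def, ← mul_assoc, mul_comm (algebraMap ℂ B a), haa, one_mul,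
        ← map_one (Ideal.Quotient.mkₐ ℂ I), ← map_add]
      congr 1; ring
  rw [← Ideal.Quotient.eq]
  exact DFunLike.congr_fun this f

theorem psi_ker {a : ℂ} (ha : a ≠ 0) {f : B} (hf : S.psi a f = 0) :
    f ∈ Ideal.span {S.x - algebraMap ℂ B a} := by
  have := S.psi_mod ha f
  rwa [hf, map_zero, sub_zero] at this

theorem finrank_quot {a : ℂ} (ha : a ≠ 0) {g : B} (hg : S.psi a g ≠ 0) :
    Module.finrank ℂ (B ⧸ Ideal.span {S.x - algebraMap ℂ B a, g}) = (S.psi a g).natDegree := by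
  let F : B →ₐ[ℂ] (R1 ⧸ Ideal.span {S.psi a g}) :=
    (Ideal.Quotient.mkₐ ℂ (Ideal.span {S.psi a g})).comp (S.psi a)
  have hF : Function.Surjective F := by
    intro u
    obtain ⟨h, rfl⟩ := Ideal.Quotient.mkₐ_surjective ℂ _ u
    exact ⟨S.sec a h, by simp only [F, AlgHom.comp_apply, S.psi_sec ha]⟩
  have hker : RingHom.ker F = Ideal.span {S.x - algebraMap ℂ B a, g} := by
    apply le_antisymm
    · intro f hf
      rw [RingHom.mem_ker] at hf
      simp only [F, AlgHom.comp_apply, Ideal.Quotient.mkₐ_eq_mk] at hf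
      rw [Ideal.Quotient.eq_zero_iff_mem, Ideal.mem_span_singleton] at hf
      obtain ⟨h, hh⟩ := hf
      have h1 : S.psi a (f - g * S.sec a h) = 0 := by
        rw [map_sub, map_mul, S.psi_sec ha, hh, sub_self]
      have h2 := S.psi_ker ha h1
      rw [Ideal.mem_span_singleton] at h2
      obtain ⟨k, hk⟩ := h2
      rw [Ideal.mem_span_pair]
      exact ⟨k, S.sec a h, by linear_combination -hk⟩
    · rw [Ideal.span_le]
      rintro u (rfl | rfl)
      · simp [F, RingHom.mem_ker, psi_x]
      · rw [SetLike.mem_coe, RingHom.mem_ker]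
        simp only [F, AlgHom.comp_apply, Ideal.Quotient.mkₐ_eq_mk]
        rw [Ideal.Quotient.eq_zero_iff_mem]
        exact Ideal.subset_span rfl
  have e := (Ideal.quotientEquivAlgOfEq ℂ hker.symm).trans (Ideal.quotientKerAlgEquivOfSurjective hF)
  rw [e.toLinearEquiv.finrank_eq, finrank_quotient_span_eq_natDegree]

theorem finrank_generic {a b : ℂ} (ha : a ≠ 0) {v : B}
    (h1 : (S.iota v).leadingCoeff.eval a ≠ 0) (h2 : ((S.iota v).coeff 0).eval a ≠ b) :
    Module.finrank ℂ (B ⧸ Ideal.span {S.x - algebraMap ℂ B a, v - algebraMap ℂ B b}) = S.d v := by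
  have hps : S.psi a (v - algebraMap ℂ B b) = S.psi a v - Polynomial.C b := by
    rw [map_sub, AlgHom.commutes]; rfl
  rw [S.finrank_quot ha, hps, Polynomial.natDegree_sub_C, psi_apply,
    Polynomial.natDegree_map_of_leadingCoeff_ne_zero _ (by simpa using h1), d]
  intro h
  rw [hps] at h
  have := congrArg (Polynomial.coeff · 0) h
  simp only [psi_apply, Polynomial.coeff_sub, Polynomial.coeff_map, Polynomial.coeff_C_zero,
    Polynomial.coeff_zero, Polynomial.coe_evalRingHom] at this
  exact h2 (sub_eq_zero.1 this)

theorem exists_nonroot {p : R1} (hp : p ≠ 0) : ∃ a : ℂ, p.eval a ≠ 0 := by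
  by_contra! h
  exact hp (Polynomial.funext (by simpa using h))

theorem L4 (φ : B ≃ₐ[ℂ] B) : S.d (φ S.x) = S.d (φ.symm S.x) := by
  have hx : S.x ≠ 0 := by
    intro h
    have := congrArg S.iota h
    simp at this
  have hne : ∀ v : B, v ≠ 0 → (S.iota v).leadingCoeff ≠ 0 := fun v hv => by
    rw [Ne, Polynomial.leadingCoeff_eq_zero]
    intro h; exact hv (S.iota_injective (by rw [h, map_zero]))
  have h1 := hne (φ S.x) (by simpa using hx)
  have h2 := hne (φ.symm S.x) (by simpa using hx)
  set q0 := (S.iota (φ.symm S.x)).coeff 0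
  obtain ⟨a, ha⟩ := exists_nonroot (p := Polynomial.X * (S.iota (φ S.x)).leadingCoeff *
    (Polynomial.X - Polynomial.C (q0.coeff 0)))
    (mul_ne_zero (mul_ne_zero Polynomial.X_ne_zero h1) (Polynomial.X_sub_C_ne_zero _))
  have hq : q0 - Polynomial.C a ≠ 0 := by
    intro h
    have := congrArg (Polynomial.coeff · 0) h
    simp only [Polynomial.coeff_sub, Polynomial.coeff_C_zero, Polynomial.coeff_zero] at this
    apply ha
    simp [sub_eq_zero.1 this]
  obtain ⟨b, hb⟩ := exists_nonroot (p := Polynomial.X * (S.iota (φ.symm S.x)).leadingCoeff *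
    (Polynomial.X - Polynomial.C (((S.iota (φ S.x)).coeff 0).eval a)) * (q0 - Polynomial.C a))
    (mul_ne_zero (mul_ne_zero (mul_ne_zero Polynomial.X_ne_zero h2) (Polynomial.X_sub_C_ne_zero _)) hq)
  simp only [Polynomial.eval_mul, Polynomial.eval_X, Polynomial.eval_sub, Polynomial.eval_C,
    mul_ne_zero_iff, sub_ne_zero] at ha hb
  obtain ⟨⟨ha0, ha1⟩, ha2⟩ := ha
  obtain ⟨⟨⟨hb0, hb1⟩, hb2⟩, hb3⟩ := hb
  rw [← S.finrank_generic ha0 ha1 hb2.symm, ← S.finrank_generic hb0 hb1 hb3]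
  apply LinearEquiv.finrank_eq
  refine (Ideal.quotientEquivAlg _ _ φ.symm ?_).toLinearEquiv
  rw [Ideal.map_span, Set.image_pair]
  simp [Set.pair_comm]

end Quad
end QF

namespace QF

structure Inv (B : Type) [CommRing B] [Algebra ℂ B] where
  f : B →+* B
  invol : ∀ b, f (f b) = b
  semi : ∀ c : ℂ, f (algebraMap ℂ B c) = algebraMap ℂ B (starRingEnd ℂ c)

namespace Inv
variable {B : Type} [CommRing B] [Algebra ℂ B] (s : Inv B)

theorem map_smul (c : ℂ) (b : B) : s.f (c • b) = (starRingEnd ℂ c) • s.f b := by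
  rw [Algebra.smul_def, map_mul, s.semi, Algebra.smul_def]

def cj (e : B ≃ₐ[ℂ] B) : Inv B where
  f := (e.symm : B →+* B).comp (s.f.comp (e : B →+* B))
  invol b := by simp [s.invol]
  semi c := by simp [s.semi]

theorem cj_apply (e : B ≃ₐ[ℂ] B) (b : B) : (s.cj e).f b = e.symm (s.f (e b)) := rfl

theorem cj_cj (e e' : B ≃ₐ[ℂ] B) : (s.cj e).cj e' = s.cj (e'.trans e) := rfl

theorem injective : Function.Injective s.f := fun a b h => by
  rw [← s.invol a, h, s.invol]

end Inv

noncomputable def cR2 : R2 →+* R2 := Polynomial.mapRingHom (Polynomial.mapRingHom (starRingEnd ℂ))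

theorem cR2_natDegree (g : R2) : (cR2 g).natDegree = g.natDegree := by
  unfold cR2
  rw [Polynomial.coe_mapRingHom]
  apply Polynomial.natDegree_map_eq_of_injective
  rw [Polynomial.coe_mapRingHom]
  exact Polynomial.map_injective _ (starRingEnd ℂ).injective

noncomputable def twist {B : Type} [CommRing B] [Algebra ℂ B] (j : B →ₐ[ℂ] R2) (s : Inv B) :
    B →ₐ[ℂ] R2 where
  toRingHom := cR2.comp ((j : B →+* R2).comp s.f)
  commutes' c := by simp [s.semi, cR2, Polynomial.algebraMap_apply]

theorem twist_apply {B : Type} [CommRing B] [Algebra ℂ B] (j : B →ₐ[ℂ] R2) (s : Inv B) (b : B) :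
    twist j s b = cR2 (j (s.f b)) := rfl

theorem twist_natDegree {B : Type} [CommRing B] [Algebra ℂ B] (j : B →ₐ[ℂ] R2) (s : Inv B) (b : B) :
    (twist j s b).natDegree = (j (s.f b)).natDegree := by rw [twist_apply, cR2_natDegree]

def CB (B : Type) : Type := B
instance {B : Type} [h : CommRing B] : CommRing (CB B) := h
noncomputable instance {B : Type} [CommRing B] [h : Algebra ℂ B] : Algebra ℂ (CB B) :=
  RingHom.toAlgebra ((algebraMap ℂ B).comp (starRingEnd ℂ))

namespace Quad
variable {B : Type} [CommRing B] [Algebra ℂ B] (S : Quad B)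

@[simp] theorem tri_symm_y (p) : (S.tri p).symm S.y =
    S.y - 2 * S.z * Polynomial.aeval S.x p + S.x * Polynomial.aeval S.x p ^ 2 := by
  simp [tri, mkEquiv]

/-- standard conjugation -/
noncomputable def cbar : B →+* B :=
  ((S.lift (R := CB B) S.x S.y S.z S.rel : B →ₐ[ℂ] CB B) : B →+* CB B)

theorem cbar_x : S.cbar S.x = S.x := S.lift_x (R := CB B) S.x S.y S.z S.rel
theorem cbar_y : S.cbar S.y = S.y := S.lift_y (R := CB B) S.x S.y S.z S.rel
theorem cbar_z : S.cbar S.z = S.z := S.lift_z (R := CB B) S.x S.y S.z S.rel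
theorem cbar_alg (c : ℂ) : S.cbar (algebraMap ℂ B c) = algebraMap ℂ B (starRingEnd ℂ c) :=
  (S.lift (R := CB B) S.x S.y S.z S.rel : B →ₐ[ℂ] CB B).commutes c

theorem cbar_cbar (f : B) : S.cbar (S.cbar f) = f := by
  refine S.ind (P := fun f => S.cbar (S.cbar f) = f) ?_ ?_ ?_ ?_ ?_ ?_ f
  · intro c; simp [cbar_alg]
  · simp [cbar_x]
  · simp [cbar_y]
  · simp [cbar_z]
  · intro f g h1 h2; rw [map_add, map_add, h1, h2]
  · intro f g h1 h2; rw [map_mul, map_mul, h1, h2]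

theorem iota_cbar (f : B) : S.iota (S.cbar f) = cR2 (S.iota f) := by
  refine S.ind (P := fun f => S.iota (S.cbar f) = cR2 (S.iota f)) ?_ ?_ ?_ ?_ ?_ ?_ f
  · intro c; simp [cbar_alg, cR2, Polynomial.algebraMap_apply]
  · simp [cbar_x, cR2]
  · simp [cbar_y, cR2]
  · simp [cbar_z, cR2]
  · intro f g h1 h2; rw [map_add, map_add, h1, h2, map_add, map_add]
  · intro f g h1 h2; rw [map_mul, map_mul, h1, h2, map_mul, map_mul]

theorem d_cbar (f : B) : S.d (S.cbar f) = S.d f := by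
  rw [d, iota_cbar, cR2_natDegree, d]

theorem L4' (s : Inv B) (e : B ≃ₐ[ℂ] B) : S.d (e.symm (s.f S.x)) = S.d (s.f (e S.x)) := by
  let F : B →ₐ[ℂ] B :=
    { toRingHom := (e.symm : B →+* B).comp (s.f.comp S.cbar)
      commutes' := fun c => by simp [s.semi, cbar_alg] }
  let G : B →ₐ[ℂ] B :=
    { toRingHom := S.cbar.comp (s.f.comp (e : B →+* B))
      commutes' := fun c => by simp [s.semi, cbar_alg] }
  have hF : ∀ b, F b = e.symm (s.f (S.cbar b)) := fun _ => rfl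
  have hG : ∀ b, G b = S.cbar (s.f (e b)) := fun _ => rfl
  let φ : B ≃ₐ[ℂ] B := AlgEquiv.ofAlgHom F G
    (by ext b; simp [hF, hG, cbar_cbar, s.invol]) (by ext b; simp [hF, hG, cbar_cbar, s.invol])
  have h := S.L4 φ
  have h1 : φ S.x = e.symm (s.f S.x) := by
    change F S.x = _
    rw [hF, cbar_x]
  have h2 : φ.symm S.x = S.cbar (s.f (e S.x)) := rfl
  rw [h1, h2, d_cbar] at h
  exact h

theorem step3 (s : Inv B) (hn : 0 < S.d (s.f S.x)) : ∃ p : R1,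
    S.d ((s.cj (S.tri p)).f S.x) = S.d (s.f S.x) ∧ S.d ((s.cj (S.tri p)).f S.z) < S.d (s.f S.x) := by
  obtain ⟨p, hp⟩ := S.L3_cor (twist S.iota s) (s.f S.x) (by
    rw [twist_apply, s.invol]; simp [cR2]) (by rw [twist_natDegree]; exact hn)
    (by rw [twist_natDegree]; rfl)
  rw [twist_natDegree, twist_natDegree] at hp
  refine ⟨p, ?_, ?_⟩
  · rw [Inv.cj_apply, tri_x, d_tri_symm]
  · rw [Inv.cj_apply, tri_z, d_tri_symm]; exact hp

/-- symbol lemma -/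
theorem symbol {A : Type} [CommRing A] [Algebra ℂ A] (j : B →ₐ[ℂ] Polynomial A) (k : ℕ)
    (hk : 0 < k) (hx : (j S.x).natDegree ≤ k) (hy : (j S.y).natDegree ≤ k)
    (hz : (j S.z).natDegree ≤ k) (t : R1 →ₐ[ℂ] A) (l : A)
    (ex : (j S.x).coeff k = l) (ey : (j S.y).coeff k = l * t (Polynomial.X ^ 2))
    (ez : (j S.z).coeff k = l * t Polynomial.X)
    {m : ℕ} {f : B} (hf : f ∈ S.V ^ m) : (j f).coeff (m * k) = l ^ m * t ((S.kappa f).coeff m) := by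
  have hV : ∀ v ∈ S.V, (j v).natDegree ≤ k ∧ (S.kappa v).natDegree ≤ 1 ∧
      (j v).coeff k = l * t ((S.kappa v).coeff 1) := by
    intro v hv
    refine ⟨?_, ?_, ?_⟩
    · have := S.pow_V_natDegree j k hx hy hz (m := 1) (f := v) (by simpa using hv)
      simpa using this
    · exact S.kappa_natDegree (m := 1) (by simpa using hv)
    · induction hv using Submodule.span_induction with
      | mem v hv =>
        rcases hv with rfl | rfl | rfl | rfl
        · simp [Polynomial.coeff_one, hk.ne']
        · simp [ex]
        · rw [ey, kappa_y]; simp [-map_pow, -Polynomial.C_pow, Polynomial.coeff_C]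
        · rw [ez, kappa_z]; simp [Polynomial.coeff_one]
      | zero => simp
      | add a b _ _ ha hb => simp only [map_add, Polynomial.coeff_add, ha, hb]; ring
      | smul a v _ h => simp only [_root_.map_smul, Polynomial.coeff_smul, h, mul_smul_comm]
  induction hf using Submodule.pow_induction_on_left' with
  | algebraMap r => simpa [Polynomial.algebraMap_apply] using (t.commutes r).symm
  | add a b i _ _ ha hb => simp only [map_add, Polynomial.coeff_add, ha, hb]; ring
  | mem_mul v hv i f hf h =>
    obtain ⟨h1, h2, h3⟩ := hV v hv
    rw [map_mul, map_mul, Nat.succ_mul, add_comm, Nat.succ_eq_add_one, add_comm i 1,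
      Polynomial.coeff_mul_add_eq_of_natDegree_le h1 (S.pow_V_natDegree j k hx hy hz hf),
      Polynomial.coeff_mul_add_eq_of_natDegree_le h2 (S.kappa_natDegree hf), h3, h, map_mul]
    ring

noncomputable def ea (a : ℂ) : B ≃ₐ[ℂ] B := S.swap.trans (S.tri (Polynomial.C a))

theorem ea_x (a : ℂ) : S.ea a S.x = S.y + (2 * a) • S.z + a ^ 2 • S.x := by
  simp [ea, Algebra.smul_def, map_ofNat]; ring
theorem ea_symm (a : ℂ) (f : B) : (S.ea a).symm f = S.swap ((S.tri (Polynomial.C a)).symm f) := rfl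

theorem ea_symbol (a : ℂ) {m : ℕ} {f : B} (hf : f ∈ S.V ^ m) :
    (S.iota ((S.ea a).symm f)).natDegree ≤ m * 2 ∧
    (S.iota ((S.ea a).symm f)).coeff (m * 2) =
      Polynomial.X ^ m * Polynomial.C (((S.kappa f).coeff m).eval (-a)) := by
  let j : B →ₐ[ℂ] R2 := S.iota.comp ((S.ea a).symm : B →ₐ[ℂ] B)
  have jx : j S.x = 2 * Polynomial.X + Polynomial.C Polynomial.X * Polynomial.X ^ 2 := by
    simp [j, ea_symm]
  have jz : j S.z = Polynomial.C (Polynomial.C (-a) * Polynomial.X) * Polynomial.X ^ 2 +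
      Polynomial.C (Polynomial.X - 2 * Polynomial.C a) * Polynomial.X + Polynomial.C 1 := by
    simp [j, ea_symm, Polynomial.algebraMap_apply, map_ofNat]; ring
  have jy : j S.y = Polynomial.C (Polynomial.C (a ^ 2) * Polynomial.X) * Polynomial.X ^ 2 +
      Polynomial.C (2 * Polynomial.C (a ^ 2) - 2 * Polynomial.C a * Polynomial.X) * Polynomial.X +
        Polynomial.C (Polynomial.X - 2 * Polynomial.C a) := by
    simp [j, ea_symm, Polynomial.algebraMap_apply, map_ofNat]; ring
  have hx : (j S.x).natDegree ≤ 2 := by rw [jx]; compute_degree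
  have hy : (j S.y).natDegree ≤ 2 := by rw [jy]; compute_degree
  have hz : (j S.z).natDegree ≤ 2 := by rw [jz]; compute_degree
  refine ⟨S.pow_V_natDegree j 2 hx hy hz hf, ?_⟩
  have := S.symbol j 2 (by norm_num) hx hy hz
    ((Algebra.ofId ℂ R1).comp (Polynomial.aeval (-a) : R1 →ₐ[ℂ] ℂ)) Polynomial.X
    (by rw [jx]; simp [Polynomial.coeff_X])
    (by rw [jy, Polynomial.coeff_add, Polynomial.coeff_add, Polynomial.coeff_C_mul_X_pow,
          Polynomial.coeff_C_mul_X, Polynomial.coeff_C]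
        simp [Algebra.ofId_apply]; ring)
    (by rw [jz, Polynomial.coeff_add, Polynomial.coeff_add, Polynomial.coeff_C_mul_X_pow,
          Polynomial.coeff_C_mul_X, Polynomial.coeff_C]
        simp [Algebra.ofId_apply]) hf
  have h2 : j f = S.iota ((S.ea a).symm f) := rfl
  rw [← h2, this]
  simp [Algebra.ofId_apply, Polynomial.aeval_def, Polynomial.eval₂_eq_eval_map]

theorem only_zero_root {F : R1} (hF : F ≠ 0) (h : ∀ a, a ≠ 0 → F.eval a ≠ 0) :
    ∃ (c : ℂ) (j : ℕ), c ≠ 0 ∧ F = Polynomial.C c * Polynomial.X ^ j := by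
  obtain ⟨G, hG, hnd⟩ := Polynomial.exists_eq_pow_rootMultiplicity_mul_and_not_dvd F hF 0
  rw [map_zero, sub_zero] at hG hnd
  have hdeg : G.degree = 0 := by
    by_contra hd
    obtain ⟨z, hz⟩ := IsAlgClosed.exists_root G hd
    by_cases hz0 : z = 0
    · subst hz0
      apply hnd
      have := Polynomial.dvd_iff_isRoot.2 hz
      simpa using this
    · apply h z hz0
      rw [hG, Polynomial.eval_mul, hz, mul_zero]
  have hc := Polynomial.eq_C_of_degree_eq_zero hdeg
  refine ⟨G.coeff 0, _, ?_, by rw [← hc, mul_comm]; exact hG⟩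
  intro h0
  rw [h0, map_zero] at hc
  rw [hc] at hdeg
  simp at hdeg

end Quad
end QF

namespace QF
namespace Quad
variable {B : Type} [CommRing B] [Algebra ℂ B] (S : Quad B)

theorem d_sy (s : Inv B) (hn : 0 < S.d (s.f S.x)) (hz : S.d (s.f S.z) < S.d (s.f S.x)) :
    S.d (s.f S.y) < S.d (s.f S.x) := by
  have h : S.iota (s.f S.x) * S.iota (s.f S.y) = S.iota (s.f S.z) ^ 2 - 1 := by
    rw [← map_mul, ← map_mul, S.rel]; simp
  by_cases hy : S.iota (s.f S.y) = 0
  · rw [d, hy]; simpa using hn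
  have hx : S.iota (s.f S.x) ≠ 0 := by
    intro h0; rw [d, h0] at hn; simp at hn
  have h1 := congrArg Polynomial.natDegree h
  rw [Polynomial.natDegree_mul hx hy] at h1
  have h2 : (S.iota (s.f S.z) ^ 2 - 1).natDegree ≤ 2 * (S.iota (s.f S.z)).natDegree := by
    refine (Polynomial.natDegree_sub_le _ _).trans ?_
    simp
  unfold d at *
  omega

theorem d_ea (s : Inv B) (hn : 0 < S.d (s.f S.x)) (hz : S.d (s.f S.z) < S.d (s.f S.x))
    {a : ℂ} (ha : a ≠ 0) : S.d ((S.ea a).symm (s.f S.x)) = S.d (s.f S.x) := by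
  rw [S.L4' s (S.ea a), ea_x, map_add, map_add, Inv.map_smul, Inv.map_smul, d, map_add, map_add,
    _root_.map_smul, _root_.map_smul]
  have hy := S.d_sy s hn hz
  unfold d at *
  have ha' : starRingEnd ℂ (a ^ 2) ≠ 0 := by simpa using ha
  have h3 : (starRingEnd ℂ (a ^ 2) • S.iota (s.f S.x)).natDegree = (S.iota (s.f S.x)).natDegree :=
    Polynomial.natDegree_smul_of_smul_regular _ (fun p q h => by
      simpa [ha] using h)
  rw [Polynomial.natDegree_add_eq_right_of_natDegree_lt, h3]
  rw [h3]
  refine (Polynomial.natDegree_add_le _ _).trans_lt (max_lt hy ?_)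
  exact (Polynomial.natDegree_smul_le _ _).trans_lt hz

theorem d_add_le (f g : B) : S.d (f + g) ≤ max (S.d f) (S.d g) := by
  unfold d; rw [map_add]; exact Polynomial.natDegree_add_le _ _
theorem d_smul_le (c : ℂ) (f : B) : S.d (c • f) ≤ S.d f := by
  unfold d; rw [_root_.map_smul]; exact Polynomial.natDegree_smul_le _ _

theorem d_V {m : ℕ} {f : B} (hf : f ∈ S.V ^ m) : S.d f ≤ m * 2 := by
  refine S.pow_V_natDegree S.iota 2 ?_ ?_ ?_ hf
  · simp
  · rw [iota_y]; compute_degree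
  · rw [iota_z]; compute_degree!

theorem d_b_le (m w : ℕ) : S.d (S.b m w) ≤ w := by
  have hy : (S.iota S.y).natDegree ≤ 2 := by rw [iota_y]; compute_degree
  have hz : (S.iota S.z).natDegree ≤ 1 := by rw [iota_z]; compute_degree
  unfold d b c
  rw [map_mul, map_mul, map_pow, map_pow, map_pow, iota_x, ← map_pow]
  refine Polynomial.natDegree_C_mul_le _ _ |>.trans ?_
  refine Polynomial.natDegree_mul_le.trans ?_
  have h1 := Polynomial.natDegree_pow_le_of_le (w / 2) hy
  have h2 := Polynomial.natDegree_pow_le_of_le (w % 2) hz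
  omega

theorem kappa_coeff_deg {m : ℕ} {f : B} (hf : f ∈ S.V ^ (m + 1)) :
    ∃ s ∈ S.Sm (m + 1), f - s ∈ S.V ^ m := by
  obtain ⟨s, hs, g, hg, rfl⟩ := Submodule.mem_sup.1 (S.V_pow_le m hf)
  exact ⟨s, hs, by simpa using hg⟩

theorem main4 (s : Inv B) (hn : 0 < S.d (s.f S.x)) (hz : S.d (s.f S.z) < S.d (s.f S.x)) :
    ∃ (m : ℕ) (c : ℂ), c ≠ 0 ∧ S.d (s.f S.x) = 2 * (m + 1) ∧ 
      s.f S.x - c • S.y ^ (m + 1) ∈ S.V ^ m ∧ (S.kappa (s.f S.x)).natDegree = m + 1 := by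
  have hea := fun a (ha : a ≠ 0) => S.d_ea s hn hz ha
  set f := s.f S.x with hf
  obtain ⟨m, hm⟩ : ∃ m, (S.kappa f).natDegree = m + 1 := by
    rcases h : (S.kappa f).natDegree with _ | m
    · exfalso
      have hV := S.mem_V_of_kappa f
      rw [h] at hV
      have := S.d_V hV
      omega
    · exact ⟨m, rfl⟩
  have hV : f ∈ S.V ^ (m + 1) := hm ▸ S.mem_V_of_kappa f
  set F := (S.kappa f).coeff (m + 1) with hF
  have hF0 : F ≠ 0 := by
    rw [hF, ← hm]
    intro h
    rw [← Polynomial.leadingCoeff, Polynomial.leadingCoeff_eq_zero] at h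
    rw [h] at hm; simp at hm
  have key : ∀ a, F.eval (-a) ≠ 0 → S.d ((S.ea a).symm f) = (m + 1) * 2 := by
    intro a h
    obtain ⟨h1, h2⟩ := S.ea_symbol a hV
    refine le_antisymm h1 (Polynomial.le_natDegree_of_ne_zero ?_)
    rw [h2]
    exact mul_ne_zero (pow_ne_zero _ Polynomial.X_ne_zero) (by simpa using h)
  have hn2 : S.d f = (m + 1) * 2 := by
    have hX : F * Polynomial.X ≠ 0 := mul_ne_zero hF0 Polynomial.X_ne_zero
    obtain ⟨a, ha⟩ : ∃ a, (F * Polynomial.X).eval a ≠ 0 := by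
      by_contra hcon
      push Not at hcon
      exact hX (Polynomial.funext (by simpa using hcon))
    rw [Polynomial.eval_mul, Polynomial.eval_X] at ha
    have := key (-a) (by rw [neg_neg]; exact left_ne_zero_of_mul ha)
    rw [← this, hea (-a) (by simpa using right_ne_zero_of_mul ha)]
  have hroots : ∀ a, a ≠ 0 → F.eval a ≠ 0 := by
    intro a ha h0
    obtain ⟨h1, h2⟩ := S.ea_symbol (-a) hV
    have h3 := hea (-a) (by simpa using ha)
    rw [neg_neg, ← hF, h0, map_zero, mul_zero] at h2
    have h4 : (S.iota ((S.ea (-a)).symm f)).natDegree = (m + 1) * 2 := by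
      rw [← hn2, ← h3]; rfl
    rw [← h4, ← Polynomial.leadingCoeff, Polynomial.leadingCoeff_eq_zero] at h2
    rw [h2] at h4; simp at h4
  obtain ⟨c, j, hc, hFc⟩ := only_zero_root hF0 hroots
  have hj : j ≤ 2 * (m + 1) := by
    by_contra hlt
    obtain ⟨g, hg, hgV⟩ := S.kappa_coeff_deg hV
    have h1 : (S.kappa (f - g)).coeff (m + 1) = 0 :=
      Polynomial.coeff_eq_zero_of_natDegree_lt (Nat.lt_succ_of_le (S.kappa_natDegree hgV))
    rw [map_sub, Polynomial.coeff_sub, sub_eq_zero, ← hF] at h1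
    have h2 := S.Sm_repr hg
    rw [← h1] at h2
    have h3 : g = 0 := by
      rw [h2]
      refine Finset.sum_eq_zero fun w hw => ?_
      rw [Finset.mem_range] at hw
      rw [hFc, Polynomial.coeff_C_mul_X_pow, if_neg (by omega), zero_smul]
    rw [h3] at h1; simp at h1; exact hF0 h1
  have hd : f - c • S.b (m + 1) j ∈ S.V ^ m := by
    refine S.V_drop (sub_mem hV (Submodule.smul_mem _ _ (S.b_mem hj))) ?_
    rw [map_sub, Polynomial.coeff_sub, _root_.map_smul, Polynomial.coeff_smul, S.kappa_b hj, ← hF, hFc,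
      Polynomial.smul_eq_C_mul, sub_self]
  have hj2 : j = 2 * (m + 1) := by
    by_contra hne
    have h1 := S.d_V hd
    have h2 := S.d_b_le (m + 1) j
    have h3 := S.d_smul_le c (S.b (m + 1) j)
    have h4 := S.d_add_le (f - c • S.b (m + 1) j) (c • S.b (m + 1) j)
    rw [sub_add_cancel] at h4
    rcases max_choice (S.d (f - c • S.b (m + 1) j)) (S.d (c • S.b (m + 1) j)) with h | h <;>
      rw [h] at h4 <;> omega
  refine ⟨m, c, hc, by omega, ?_, hm⟩
  have hb : S.b (m + 1) j = S.y ^ (m + 1) := by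
    subst hj2
    unfold b Quad.c
    rw [show (2 * (m + 1) + 1) / 2 = m + 1 by omega, show (2 * (m + 1)) / 2 = m + 1 by omega]
    simp
  rwa [hb] at hd

theorem main5 (s : Inv B) (hmin : ∀ e, S.d (s.f S.x) ≤ S.d ((s.cj e).f S.x))
    (hn : 0 < S.d (s.f S.x)) (hz : S.d (s.f S.z) < S.d (s.f S.x)) :
    ∃ c b : ℂ, c ≠ 0 ∧ s.f S.x = c • S.y + algebraMap ℂ B b := by
  obtain ⟨m, c, hc, hd, hV, hk⟩ := S.main4 s hn hz
  rcases m with _ | m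
  · obtain ⟨b, hb⟩ := S.V_zero hV
    refine ⟨c, b, hc, ?_⟩
    rw [← hb]; simp
  exfalso
  let κ := twist S.kappa s
  have k1 : (κ (s.f S.x)).natDegree = 1 := by
    simp only [κ]
    rw [twist_natDegree, s.invol, kappa_x, Polynomial.natDegree_X]
  have k2 : (κ S.x).natDegree = m + 2 := by
    simp only [κ]
    rw [twist_natDegree, hk]
  set j := (κ S.y).natDegree with hj
  have hx0 : κ S.x ≠ 0 := by intro h; rw [h] at k2; simp at k2
  have hjm : j < m + 2 := by
    by_contra hle
    push Not at hle
    have hy0 : κ S.y ≠ 0 := by intro h; rw [h] at hj; simp at hj; omega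
    have hzz : (κ S.z).natDegree ≤ j := by
      by_contra hlt
      push Not at hlt
      have h := congrArg κ S.rel
      rw [map_mul, map_sub, map_pow, map_one] at h
      have h1 := congrArg Polynomial.natDegree h
      rw [Polynomial.natDegree_mul hx0 hy0, ← Polynomial.C_1, Polynomial.natDegree_sub_C,
        Polynomial.natDegree_pow] at h1
      omega
    have h1 := S.pow_V_natDegree κ j (by omega) le_rfl hzz hV
    have h2 : (κ (c • S.y ^ (m + 1 + 1))).natDegree = (m + 2) * j := by
      rw [_root_.map_smul, map_pow, Polynomial.natDegree_smul_of_smul_regular _ (fun p q h => by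
      simpa [hc] using h), Polynomial.natDegree_pow]
    have h3 : (κ (s.f S.x)).natDegree = (m + 2) * j := by
      have : κ (s.f S.x) = κ (s.f S.x - c • S.y ^ (m + 1 + 1)) + κ (c • S.y ^ (m + 1 + 1)) := by
        rw [← map_add, sub_add_cancel]
      rw [this, Polynomial.natDegree_add_eq_right_of_natDegree_lt, h2]
      rw [h2]
      refine h1.trans_lt ?_
      nlinarith
    rw [k1] at h3
    nlinarith
  have hj' : (S.kappa (s.f S.y)).natDegree = j := by rw [hj]; simp only [κ]; rw [twist_natDegree]
  have hVy := S.mem_V_of_kappa (s.f S.y)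
  rw [hj'] at hVy
  have h1 := S.pow_V_natDegree (S.iota.comp (S.swap : B →ₐ[ℂ] B)) 2
    (by simp; compute_degree) (by simp) (by simp; compute_degree!) hVy
  have h2 := hmin S.swap
  rw [Inv.cj_apply, swap_x, swap_symm] at h2
  have h3 : S.d (S.swap (s.f S.y)) ≤ j * 2 := h1
  omega

end Quad
end QF

namespace QF
namespace Quad
variable {B : Type} [CommRing B] [Algebra ℂ B] (S : Quad B)

theorem PR (s : Inv B) (u : B) (ψ : B →ₐ[ℂ] R1) (hψu : ψ u = 0)
    (hker : ∀ f, ψ f = 0 → u ∣ f) (c : ℂ) (hc : c ≠ 0) (hx : s.f S.x = c • u) : False := by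
  have hr : s.f S.x * s.f S.y = (s.f S.z - 1) * (s.f S.z + 1) := by
    rw [← map_mul, S.rel]; simp; ring
  have h0 : ψ (s.f S.z - 1) * ψ (s.f S.z + 1) = 0 := by
    rw [← map_mul, ← hr, map_mul, hx, _root_.map_smul, hψu]; simp
  have hdvd : ∀ w : B, u ∣ s.f w → S.x ∣ w := by
    rintro w ⟨g, hg⟩
    have : u = c⁻¹ • s.f S.x := by rw [hx, smul_smul, inv_mul_cancel₀ hc, one_smul]
    rw [this] at hg
    have h2 := congrArg s.f hg
    rw [s.invol, map_mul, Inv.map_smul, s.invol] at h2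
    rw [h2, smul_mul_assoc]
    rw [← mul_smul_comm]
    exact dvd_mul_right _ _
  rcases mul_eq_zero.1 h0 with h | h
  · have h1 := hker _ h
    obtain ⟨g, hg⟩ := hdvd (S.z - 1) (by simpa using h1)
    have h3 := congrArg (S.lift (0 : ℂ) 0 (-1) (by norm_num)) hg
    simp at h3; norm_num at h3
  · have h1 := hker _ h
    obtain ⟨g, hg⟩ := hdvd (S.z + 1) (by simpa using h1)
    have h3 := congrArg (S.lift (0 : ℂ) 0 1 (by norm_num)) hg
    simp at h3

theorem PR_x (s : Inv B) (a b : ℂ) (ha : a ≠ 0) (hx : s.f S.x = a • S.x + algebraMap ℂ B b) :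
    b = 0 := by
  by_contra hb
  have hb' : -b / a ≠ 0 := by simp [ha, hb]
  refine S.PR s (S.x - algebraMap ℂ B (-b / a)) (S.psi (-b/a)) ?_ ?_ a ha ?_
  · rw [map_sub, psi_x, AlgHom.commutes]; exact sub_self _
  · intro f hf
    exact Ideal.mem_span_singleton.1 (S.psi_ker hb' hf)
  · rw [hx, smul_sub, Algebra.algebraMap_eq_smul_one, Algebra.algebraMap_eq_smul_one, smul_smul,
      mul_div_cancel₀ _ ha]; simp

theorem PR_y (s : Inv B) (a b : ℂ) (ha : a ≠ 0) (hx : s.f S.x = a • S.y + algebraMap ℂ B b) :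
    b = 0 := by
  by_contra hb
  have hb' : -b / a ≠ 0 := by simp [ha, hb]
  refine S.PR s (S.y - algebraMap ℂ B (-b / a)) ((S.psi (-b/a)).comp (S.swap : B →ₐ[ℂ] B)) ?_ ?_ a ha ?_
  · simp only [AlgHom.comp_apply, AlgEquiv.coe_toAlgHom, AlgHom.coe_coe]
    rw [map_sub, swap_y, AlgEquiv.commutes, map_sub, psi_x, AlgHom.commutes]; exact sub_self _
  · intro f hf
    obtain ⟨g, hg⟩ := Ideal.mem_span_singleton.1 (S.psi_ker hb' (f := S.swap f) hf)
    refine ⟨S.swap.symm g, ?_⟩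
    have := congrArg S.swap.symm hg
    simp only [AlgEquiv.symm_apply_apply] at this
    rw [this, map_mul, map_sub, AlgEquiv.commutes, swap_symm, swap_x]
  · rw [hx, smul_sub, Algebra.algebraMap_eq_smul_one, Algebra.algebraMap_eq_smul_one, smul_smul,
      mul_div_cancel₀ _ ha]; simp

theorem aeval_x_inj {p q : R1} (h : Polynomial.aeval S.x p = Polynomial.aeval S.x q) : p = q := by
  have := congrArg S.iota h
  rw [← Polynomial.aeval_algHom_apply, ← Polynomial.aeval_algHom_apply, iota_x, aeval_CX, aeval_CX] at this
  exact Polynomial.C_injective this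

theorem lin_inj {p q p' q' : R1} (h : Polynomial.aeval S.x p * S.z + Polynomial.aeval S.x q =
    Polynomial.aeval S.x p' * S.z + Polynomial.aeval S.x q') : p = p' ∧ q = q' := by
  have := congrArg S.iota h
  simp only [map_add, map_mul, iota_z] at this
  simp only [← Polynomial.aeval_algHom_apply, iota_x, aeval_CX] at this
  have h1 := congrArg (fun g => Polynomial.coeff g 1) this
  have h0 := congrArg (fun g => Polynomial.coeff g 0) this
  simp [Polynomial.coeff_one, Polynomial.coeff_C] at h1 h0
  subst h1
  exact ⟨rfl, by simpa using h0⟩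

theorem d_zero {f : B} (h : S.d f = 0) : ∃ q : R1, f = Polynomial.aeval S.x q := by
  by_cases hf : f = 0
  · exact ⟨0, by simp [hf]⟩
  obtain ⟨Q, hQ, hQ2⟩ := S.exists_Q hf
  have h1 := S.d_of_Q hQ2
  rw [h] at h1
  rw [← h1] at hQ2
  rw [Polynomial.eq_C_of_natDegree_eq_zero h1.symm] at hQ2
  refine ⟨Q.coeff 0, ?_⟩
  simpa [ev] using hQ2

theorem semi_aeval (s : Inv B) (q : R1) (u : B) : s.f (Polynomial.aeval u q) =
    Polynomial.aeval (s.f u) (q.map (starRingEnd ℂ)) := by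
  rw [Polynomial.aeval_def, Polynomial.aeval_def, Polynomial.hom_eval₂, Polynomial.eval₂_map]
  congr 1
  ext c <;> simp [s.semi]

theorem xcancel {u v : B} (h : S.x * u = S.x * v) : u = v := by
  have := S.isDomain
  refine mul_left_cancel₀ ?_ h
  intro h0
  have := congrArg S.iota h0
  simp at this

theorem n0_x (s : Inv B) (h : S.d (s.f S.x) = 0) : ∃ e, (s.cj e).f S.x = S.x := by
  obtain ⟨q, hq⟩ := S.d_zero h
  have h1 := s.invol S.x
  rw [hq, semi_aeval, hq, ← Polynomial.aeval_comp] at h1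
  have h2 : (q.map (starRingEnd ℂ)).comp q = Polynomial.X := S.aeval_x_inj (by rw [h1]; simp)
  have h3 := congrArg Polynomial.natDegree h2
  rw [Polynomial.natDegree_comp, Polynomial.natDegree_map, Polynomial.natDegree_X] at h3
  have h4 : q.natDegree = 1 := Nat.eq_one_of_mul_eq_one_left h3
  obtain ⟨a, b, hab⟩ := Polynomial.exists_eq_X_add_C_of_natDegree_le_one h4.le
  have ha : a ≠ 0 := by
    rintro rfl
    rw [hab] at h4; simp at h4
  have hx : s.f S.x = a • S.x + algebraMap ℂ B b := by
    rw [hq, hab]; simp [Algebra.smul_def]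
  have hb := S.PR_x s a b ha hx
  rw [hb, map_zero, add_zero] at hx
  have h5 := s.invol S.x
  rw [hx, Inv.map_smul, hx, smul_smul] at h5
  have h6 : starRingEnd ℂ a * a = 1 := by
    have := congrArg S.iota h5
    rw [_root_.map_smul, iota_x] at this
    have := congrArg (fun g => (Polynomial.coeff g 0).coeff 1) this
    simpa using this
  obtain ⟨l, hl⟩ := IsSquare.exists_sq a (IsAlgClosed.exists_pow_nat_eq a (n := 2) (by norm_num) |>.elim
    fun z hz => ⟨z, by rw [← hz, sq]⟩)
  have hl0 : l ≠ 0 := by rintro rfl; simp at hl; exact ha hl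
  have hll : starRingEnd ℂ l * l = 1 := by
    rw [mul_comm, Complex.mul_conj] at h6 ⊢
    rw [hl, map_pow] at h6
    norm_cast at h6 ⊢
    nlinarith [Complex.normSq_nonneg l]
  refine ⟨S.scale l hl0, ?_⟩
  rw [Inv.cj_apply, scale_x, Inv.map_smul, hx, _root_.map_smul, _root_.map_smul, scale_symm_x,
    smul_smul, smul_smul]
  have : starRingEnd ℂ l * a * l⁻¹ = 1 := by
    rw [hl]; field_simp; linear_combination hll
  rw [this, one_smul]

theorem n0_z (s : Inv B) (hx : s.f S.x = S.x) : ∃ e, (s.cj e).f S.x = S.x ∧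
    (s.cj e).f S.y = S.y ∧ ((s.cj e).f S.z = S.z ∨ (s.cj e).f S.z = - S.z) := by
  have hdom := S.isDomain
  have hz0 : s.f S.z ≠ 0 := by
    intro h
    have h2 := s.invol S.z
    rw [h, map_zero] at h2
    have := congrArg (S.lift (0 : ℂ) 0 1 (by norm_num)) h2
    simp at this
  obtain ⟨Q, hQ, hQ2⟩ := S.exists_Q hz0
  have hN := S.d_of_Q hQ2
  have hj := congrArg (twist S.iota s) hQ2
  rw [map_ev, map_mul, map_pow] at hj
  simp only [twist_apply, s.invol, hx] at hj
  have cx : cR2 (S.iota S.x) = Polynomial.C Polynomial.X := by simp [cR2]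
  have cz : cR2 (S.iota S.z) = 1 + Polynomial.C Polynomial.X * Polynomial.X := by simp [cR2]
  rw [cx, cz, ev_CX, ← map_pow] at hj
  have h1 := congrArg Polynomial.natDegree hj
  rw [Polynomial.natDegree_comp, cR2_natDegree, Polynomial.natDegree_C_mul
    (pow_ne_zero _ Polynomial.X_ne_zero)] at h1
  have h2 : (1 + Polynomial.C Polynomial.X * Polynomial.X : R2).natDegree = 1 := by
    compute_degree!
  have h3 : (S.iota (s.f S.z)).natDegree = Q.natDegree := hN
  rw [h2, h3] at h1
  have h4 : Q.natDegree = 1 := Nat.eq_one_of_mul_eq_one_left h1.symm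
  obtain ⟨α, β, hab⟩ := Polynomial.exists_eq_X_add_C_of_natDegree_le_one h4.le
  rw [h4, hab] at hQ2
  have hz : s.f S.z = Polynomial.aeval S.x α * S.z + Polynomial.aeval S.x β := by
    simpa [ev] using hQ2
  have h5 := s.invol S.z
  rw [hz, map_add, map_mul, hz, semi_aeval, semi_aeval, hx] at h5
  have h6 := S.lin_inj (p := (α.map (starRingEnd ℂ)) * α)
    (q := (α.map (starRingEnd ℂ)) * β + β.map (starRingEnd ℂ)) (p' := 1) (q' := 0) (by
      simp only [map_add, map_mul, map_one, map_zero]; linear_combination h5)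
  obtain ⟨h6, h7⟩ := h6
  have hu : IsUnit α := IsUnit.of_mul_eq_one _ (by rw [mul_comm]; exact h6)
  obtain ⟨a0, -, ha0⟩ := Polynomial.isUnit_iff.1 hu
  have hr : S.x * s.f S.y = (s.f S.z) ^ 2 - 1 := by
    nth_rewrite 1 [← hx]
    rw [← map_mul, S.rel]; simp
  have hev : ∀ (ε : ℂ) (h : ε ^ 2 = 1), (a0 * ε + β.eval 0) ^ 2 = 1 := by
    intro ε h
    have := congrArg (S.lift (0 : ℂ) 0 ε (by rw [h]; ring)) hr
    rw [hz, ← ha0] at this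
    simp only [map_add, map_mul, map_sub, map_pow, map_one, lift_x, lift_z,
      ← Polynomial.aeval_algHom_apply, zero_mul, Polynomial.aeval_C] at this
    rw [Polynomial.coe_aeval_eq_eval, AlgHom.commutes, Algebra.algebraMap_self_apply] at this
    linear_combination -this
  have e1 := hev 1 (by norm_num)
  have e2 := hev (-1) (by norm_num)
  have ha00 : a0 ≠ 0 := by rintro rfl; rw [← ha0] at hu; simp at hu
  have hβ0 : β.eval 0 = 0 := by
    have : a0 * β.eval 0 = 0 := by linear_combination (e1 - e2) / 4
    exact (mul_eq_zero.1 this).resolve_left ha00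
  have hsq : a0 ^ 2 = 1 := by rw [hβ0] at e1; linear_combination e1
  have hconj : starRingEnd ℂ a0 = a0 := by
    rcases sq_eq_one_iff.1 hsq with h | h <;> simp [h]
  obtain ⟨p, hp⟩ := (Polynomial.X_dvd_iff (f := β)).2 (by rw [Polynomial.coeff_zero_eq_eval_zero]; exact hβ0)
  rw [← ha0, hp, Polynomial.map_C, hconj, Polynomial.map_mul, Polynomial.map_X] at h7
  have h8 : Polynomial.C a0 * p + p.map (starRingEnd ℂ) = 0 := by
    have : Polynomial.X * (Polynomial.C a0 * p + p.map (starRingEnd ℂ)) = 0 := by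
      linear_combination h7
    exact (mul_eq_zero.1 this).resolve_left Polynomial.X_ne_zero
  let q : R1 := Polynomial.C (a0 / 2) * p
  have hqm : q.map (starRingEnd ℂ) = Polynomial.C (a0 / 2) * p.map (starRingEnd ℂ) := by
    simp [q, Polynomial.map_mul, hconj, map_ofNat]
  have hx' : (s.cj (S.tri q)).f S.x = S.x := by rw [Inv.cj_apply, tri_x, hx, tri_symm_x]
  have hz' : (s.cj (S.tri q)).f S.z = a0 • S.z := by
    rw [Inv.cj_apply, tri_z, map_add, map_mul, semi_aeval, hx, hz, ← ha0, hp]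
    simp only [map_add, map_mul, ← Polynomial.aeval_algHom_apply, tri_symm_x, tri_symm_z,
      Polynomial.aeval_C, Polynomial.aeval_X, AlgEquiv.commutes]
    rw [hqm]
    have h9 : p.map (starRingEnd ℂ) = - (Polynomial.C a0 * p) := by linear_combination h8
    rw [h9]
    simp only [q, map_mul, map_neg, Polynomial.aeval_C, Algebra.smul_def]
    have hs2 : algebraMap ℂ B a0 * algebraMap ℂ B (a0 / 2) = algebraMap ℂ B (1/2) := by
      rw [← map_mul]; congr 1; linear_combination hsq / 2
    have hs3 : algebraMap ℂ B (1/2) * 2 = 1 := by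
      have : (2 : B) = algebraMap ℂ B 2 := by simp [map_ofNat]
      rw [this, ← map_mul]; norm_num
    linear_combination (-2 * S.x * Polynomial.aeval S.x p) * hs2 - (S.x * Polynomial.aeval S.x p) * hs3
  have hy' : (s.cj (S.tri q)).f S.y = S.y := by
    apply S.xcancel
    rw [S.rel]
    nth_rewrite 1 [← hx']
    rw [← map_mul, S.rel, map_sub, map_pow, hz', map_one, smul_pow, hsq, one_smul]
  refine ⟨S.tri q, hx', hy', ?_⟩
  rcases sq_eq_one_iff.1 hsq with h | h <;> simp [h, hz']

theorem n2 (s : Inv B) (c : ℂ) (hc : c ≠ 0) (hx : s.f S.x = c • S.y) : ∃ e, 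
    ((s.cj e).f S.x = S.y ∧ (s.cj e).f S.y = S.x ∨ (s.cj e).f S.x = - S.y ∧ (s.cj e).f S.y = - S.x) ∧
     ((s.cj e).f S.z = S.z ∨ (s.cj e).f S.z = - S.z) := by
  have hdom := S.isDomain
  have hc' : starRingEnd ℂ c ≠ 0 := by simpa using hc
  have hy : s.f S.y = (starRingEnd ℂ c)⁻¹ • S.x := by
    have h := s.invol S.x
    rw [hx, Inv.map_smul] at h
    rw [← h, smul_smul, inv_mul_cancel₀ hc', one_smul]
  have hzz : (s.f S.z) ^ 2 = 1 + (c * (starRingEnd ℂ c)⁻¹) • (S.z ^ 2 - 1) := by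
    have h : s.f S.x * s.f S.y = (s.f S.z) ^ 2 - 1 := by rw [← map_mul, S.rel]; simp
    rw [hx, hy, smul_mul_smul_comm, mul_comm S.y, S.rel] at h
    rw [h]; ring
  set γ := c * (starRingEnd ℂ c)⁻¹ with hγ
  have hγ0 : γ ≠ 0 := mul_ne_zero hc (inv_ne_zero hc')
  have hg := congrArg (S.psi 1) hzz
  rw [map_pow, map_add, map_one, _root_.map_smul, map_sub, map_pow, psi_z, map_one, map_one, one_mul,
    Polynomial.smul_eq_C_mul] at hg
  have hgd : (S.psi 1 (s.f S.z)).natDegree ≤ 1 := by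
    have h1 := congrArg Polynomial.natDegree hg
    rw [Polynomial.natDegree_pow] at h1
    have h2 : (1 + Polynomial.C γ * ((1 + Polynomial.X) ^ 2 - 1)).natDegree ≤ 2 := by
      compute_degree
    omega
  obtain ⟨u, v, huv⟩ := Polynomial.exists_eq_X_add_C_of_natDegree_le_one hgd
  rw [huv] at hg
  have g0 := congrArg (Polynomial.eval 0) hg
  have g1 := congrArg (Polynomial.eval 1) hg
  have g2 := congrArg (Polynomial.eval (-1)) hg
  simp only [Polynomial.eval_pow, Polynomial.eval_add, Polynomial.eval_mul, Polynomial.eval_C,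
    Polynomial.eval_X, Polynomial.eval_sub, Polynomial.eval_one] at g0 g1 g2
  have f0 : v ^ 2 = 1 := by linear_combination g0
  have f1 : u ^ 2 = γ := by linear_combination (g1 + g2) / 2 - f0
  have f2 : u * v = γ := by linear_combination (g1 - g2) / 4
  have hγ1 : γ = 1 := by
    have : γ * (γ - 1) = 0 := by
      have : γ * γ = γ := by
        calc γ * γ = (u * v) * (u * v) := by rw [f2]
          _ = u ^ 2 * v ^ 2 := by ring
          _ = γ := by rw [f1, f0, mul_one]
      linear_combination this
    exact sub_eq_zero.1 ((mul_eq_zero.1 this).resolve_left hγ0)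
  rw [hγ1, one_smul, add_sub_cancel] at hzz
  have hz := sq_eq_sq_iff_eq_or_eq_neg.1 hzz
  have hcc : starRingEnd ℂ c = c := by
    rw [hγ] at hγ1; field_simp at hγ1; exact hγ1.symm
  obtain ⟨r, rfl⟩ := Complex.conj_eq_iff_real.1 hcc
  have hr : r ≠ 0 := by simpa using hc
  rw [hcc] at hy
  have hra : 0 < |r| := abs_pos.2 hr
  let l : ℝ := √(|r|⁻¹)
  have hl2 : l ^ 2 = |r|⁻¹ := Real.sq_sqrt (inv_nonneg.2 hra.le)
  have hl : l ≠ 0 := by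
    intro h; rw [h] at hl2; simp at hl2; exact hra.ne hl2
  have hlc : (l : ℂ) ≠ 0 := by exact_mod_cast hl
  have hδ : l ^ 2 * r = 1 ∨ l ^ 2 * r = -1 := by
    rw [hl2]
    rcases abs_choice r with h | h <;> rw [h]
    · left; field_simp
    · right; field_simp
  refine ⟨S.scale l hlc, ?_, ?_⟩
  · have hx' : (s.cj (S.scale l hlc)).f S.x = ((l ^ 2 * r : ℝ) : ℂ) • S.y := by
      rw [Inv.cj_apply, scale_x, Inv.map_smul, hx, _root_.map_smul, _root_.map_smul, scale_symm_y,
        smul_smul, smul_smul, Complex.conj_ofReal]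
      congr 1; push_cast; ring
    have hy' : (s.cj (S.scale l hlc)).f S.y = (((l ^ 2 * r)⁻¹ : ℝ) : ℂ) • S.x := by
      rw [Inv.cj_apply, scale_y, Inv.map_smul, hy, _root_.map_smul, _root_.map_smul, scale_symm_x,
        smul_smul, smul_smul, ← Complex.ofReal_inv, Complex.conj_ofReal]
      congr 1; push_cast; field_simp
    rw [hx', hy']
    rcases hδ with h | h <;> rw [h]
    · left; simp
    · right; simp
  · rw [Inv.cj_apply, scale_z]
    rcases hz with h | h <;> simp [h]

theorem normal (s : Inv B) : ∃ e, 
    ((s.cj e).f S.x = S.x ∧ (s.cj e).f S.y = S.y ∨ 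
    (s.cj e).f S.x = S.y ∧ (s.cj e).f S.y = S.x ∨ (s.cj e).f S.x = - S.y ∧ (s.cj e).f S.y = - S.x) ∧
     ((s.cj e).f S.z = S.z ∨ (s.cj e).f S.z = - S.z) := by
  classical
  have hex : ∃ k, ∃ e, S.d ((s.cj e).f S.x) = k := ⟨_, AlgEquiv.refl, rfl⟩
  obtain ⟨e, he⟩ := Nat.find_spec hex
  have hmin : ∀ e', S.d ((s.cj e).f S.x) ≤ S.d (((s.cj e).cj e').f S.x) := by
    intro e'
    rw [he]
    exact Nat.find_min' hex ⟨e'.trans e, rfl⟩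
  suffices H : ∃ e', 
    (((s.cj e).cj e').f S.x = S.x ∧ ((s.cj e).cj e').f S.y = S.y ∨ 
    ((s.cj e).cj e').f S.x = S.y ∧ ((s.cj e).cj e').f S.y = S.x ∨
      ((s.cj e).cj e').f S.x = - S.y ∧ ((s.cj e).cj e').f S.y = - S.x) ∧
     (((s.cj e).cj e').f S.z = S.z ∨ ((s.cj e).cj e').f S.z = - S.z) by
    obtain ⟨e', h⟩ := H
    rw [Inv.cj_cj] at h
    exact ⟨e'.trans e, h⟩
  clear he
  generalize s.cj e = t at hmin
  rcases Nat.eq_zero_or_pos (S.d (t.f S.x)) with h | h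
  · obtain ⟨e1, h1⟩ := S.n0_x t h
    obtain ⟨e2, h2, h3, h4⟩ := S.n0_z _ h1
    rw [Inv.cj_cj] at h2 h3 h4
    exact ⟨e2.trans e1, Or.inl ⟨h2, h3⟩, h4⟩
  · obtain ⟨p, hp1, hp2⟩ := S.step3 t h
    rw [← hp1] at hp2 h
    obtain ⟨c, b, hc, hcb⟩ := S.main5 (t.cj (S.tri p)) (by
      intro e'
      rw [hp1, Inv.cj_cj]; exact hmin (e'.trans (S.tri p))) h hp2
    have hb := S.PR_y _ c b hc hcb
    rw [hb, map_zero, add_zero] at hcb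
    obtain ⟨e1, h1, h2⟩ := S.n2 _ c hc hcb
    rw [Inv.cj_cj] at h1 h2
    exact ⟨e1.trans (S.tri p), Or.inr h1, h2⟩

end Quad
end QF

namespace QF

/-- conjugation on the complexification -/
noncomputable def cT (A : Type) [CommRing A] [Algebra ℝ A] : ℂ ⊗[ℝ] A →ₐ[ℝ] ℂ ⊗[ℝ] A :=
  Algebra.TensorProduct.map (Complex.conjAe : ℂ →ₐ[ℝ] ℂ) (AlgHom.id ℝ A)

theorem cT_tmul (A : Type) [CommRing A] [Algebra ℝ A] (c : ℂ) (a : A) :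
    cT A (c ⊗ₜ a) = (starRingEnd ℂ c) ⊗ₜ a := by
  simp [cT]

theorem cT_cT (A : Type) [CommRing A] [Algebra ℝ A] (u : ℂ ⊗[ℝ] A) : cT A (cT A u) = u := by
  induction u with
  | zero => simp
  | tmul c a => simp [cT_tmul]
  | add u v h1 h2 => rw [map_add, map_add, h1, h2]

theorem cT_alg (A : Type) [CommRing A] [Algebra ℝ A] (c : ℂ) :
    cT A (algebraMap ℂ _ c) = algebraMap ℂ _ (starRingEnd ℂ c) := by
  rw [Algebra.TensorProduct.algebraMap_apply, Algebra.TensorProduct.algebraMap_apply]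
  simp [cT_tmul]

theorem repr (A : Type) [CommRing A] [Algebra ℝ A] (u : ℂ ⊗[ℝ] A) :
    ∃ a b : A, u = 1 ⊗ₜ a + Complex.I ⊗ₜ b := by
  induction u with
  | zero => exact ⟨0, 0, by simp⟩
  | tmul c a =>
    refine ⟨c.re • a, c.im • a, ?_⟩
    rw [← TensorProduct.smul_tmul, ← TensorProduct.smul_tmul, ← TensorProduct.add_tmul]
    congr 1
    apply Complex.ext <;> simp
  | add u v h1 h2 =>
    obtain ⟨a, b, rfl⟩ := h1
    obtain ⟨a', b', rfl⟩ := h2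
    exact ⟨a + a', b + b', by rw [TensorProduct.tmul_add, TensorProduct.tmul_add]; ring⟩

theorem fixed_iff (A : Type) [CommRing A] [Algebra ℝ A] (u : ℂ ⊗[ℝ] A) :
    u ∈ (Algebra.TensorProduct.includeRight : A →ₐ[ℝ] ℂ ⊗[ℝ] A).range ↔ cT A u = u := by
  constructor
  · rintro ⟨a, rfl⟩
    simp [cT_tmul]
  · intro h
    obtain ⟨a, b, rfl⟩ := repr A u
    rw [map_add, cT_tmul, cT_tmul, map_one, Complex.conj_I, TensorProduct.neg_tmul] at h
    have h2 : (2 : ℂ) • (Complex.I ⊗ₜ[ℝ] b) = 0 := by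
      rw [two_smul]; linear_combination -h
    have h3 : Complex.I ⊗ₜ[ℝ] b = 0 := by
      have := congrArg (fun v => (2⁻¹ : ℂ) • v) h2
      simpa [smul_smul] using this
    rw [h3, add_zero]
    exact ⟨a, rfl⟩

theorem descent {A A' : Type} [CommRing A] [Algebra ℝ A] [CommRing A'] [Algebra ℝ A']
    (Ψ : ℂ ⊗[ℝ] A ≃ₐ[ℂ] ℂ ⊗[ℝ] A') (h : ∀ u, Ψ (cT A u) = cT A' (Ψ u)) : Nonempty (A ≃ₐ[ℝ] A') := by
  let Φ : ℂ ⊗[ℝ] A ≃ₐ[ℝ] ℂ ⊗[ℝ] A' := Ψ.restrictScalars ℝ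
  have hi : ∀ (A : Type) [CommRing A] [Algebra ℝ A],
      Function.Injective (Algebra.TensorProduct.includeRight : A →ₐ[ℝ] ℂ ⊗[ℝ] A) := by
    intro A _ _
    exact Algebra.TensorProduct.includeRight_injective (algebraMap ℝ ℂ).injective
  let e1 := AlgEquiv.ofInjective _ (hi A)
  let e2 := AlgEquiv.ofInjective _ (hi A')
  let e3 := Φ.subalgebraMap (Algebra.TensorProduct.includeRight : A →ₐ[ℝ] ℂ ⊗[ℝ] A).range
  have heq : (Algebra.TensorProduct.includeRight : A →ₐ[ℝ] ℂ ⊗[ℝ] A).range.map (Φ : _ →ₐ[ℝ] _) =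
      (Algebra.TensorProduct.includeRight : A' →ₐ[ℝ] ℂ ⊗[ℝ] A').range := by
    ext v
    rw [fixed_iff, Subalgebra.mem_map]
    constructor
    · rintro ⟨u, hu, rfl⟩
      rw [fixed_iff] at hu
      change cT A' (Ψ u) = Ψ u
      rw [← h, hu]
    · intro hv
      refine ⟨Ψ.symm v, ?_, Ψ.apply_symm_apply v⟩
      rw [fixed_iff]
      apply Ψ.injective
      rw [h, Ψ.apply_symm_apply, hv]
  exact ⟨e1.trans (e3.trans ((Subalgebra.equivOfEq _ _ heq).trans e2.symm))⟩

abbrev Rq (q : MvPolynomial (Fin 3) ℝ) := MvPolynomial (Fin 3) ℝ ⧸ Ideal.span {q}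

theorem aeval_mk (q : MvPolynomial (Fin 3) ℝ) : 
    aeval (fun k => (1 : ℂ) ⊗ₜ[ℝ] (Ideal.Quotient.mk (Ideal.span {q}) (X k))) q = (0 : ℂ ⊗[ℝ] Rq q) := by
  have h : (Algebra.TensorProduct.includeRight : Rq q →ₐ[ℝ] ℂ ⊗[ℝ] Rq q).comp
      (Ideal.Quotient.mkₐ ℝ (Ideal.span {q})) = 
      aeval (fun k => (1 : ℂ) ⊗ₜ[ℝ] (Ideal.Quotient.mk (Ideal.span {q}) (X k))) := by
    ext k; simp
  rw [← h]
  simp only [AlgHom.comp_apply, Ideal.Quotient.mkₐ_eq_mk]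
  rw [Ideal.Quotient.eq_zero_iff_mem.2 (Ideal.mem_span_singleton_self q), map_zero]

namespace Quad
variable {B : Type} [CommRing B] [Algebra ℂ B] (S : Quad B)

noncomputable def w : Fin 3 → B :=
  ![(1/2 : ℂ) • (S.x + S.y), (1/2 : ℂ) • (S.x - S.y), S.z]

theorem w_x : S.w 0 + S.w 1 = S.x := by
  simp only [w, Matrix.cons_val_zero, Matrix.cons_val_one]
  rw [← smul_add, show S.x + S.y + (S.x - S.y) = (2 : ℂ) • S.x by rw [two_smul]; ring, smul_smul]
  norm_num

theorem w_y : S.w 0 - S.w 1 = S.y := by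
  simp only [w, Matrix.cons_val_zero, Matrix.cons_val_one]
  rw [← smul_sub, show S.x + S.y - (S.x - S.y) = (2 : ℂ) • S.y by rw [two_smul]; ring, smul_smul]
  norm_num

theorem w_z : S.w 2 = S.z := rfl

theorem w_rel : S.w 0 ^ 2 - S.w 1 ^ 2 - S.w 2 ^ 2 + 1 = 0 := by
  have := S.rel
  rw [← S.w_x, ← S.w_y, ← S.w_z] at this
  linear_combination this

theorem realize [Algebra ℝ B] [IsScalarTower ℝ ℂ B] (q : MvPolynomial (Fin 3) ℝ)
    (ρ : Fin 3 → ℂ) (π : Equiv.Perm (Fin 3)) (κ : ℂ) (hκ : κ ≠ 0) (hρ : ∀ k, ρ k ≠ 0)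
    (H : ∀ (D : Type) [CommRing D] [Algebra ℂ D] [Algebra ℝ D] [IsScalarTower ℝ ℂ D] (W : Fin 3 → D),
      aeval (fun k => ρ k • W (π k)) q = κ • (W 0 ^ 2 - W 1 ^ 2 - W 2 ^ 2 + 1)) :
    ∃ F : ℂ ⊗[ℝ] Rq q ≃ₐ[ℂ] B, ∀ k, F (1 ⊗ₜ Ideal.Quotient.mk _ (X k)) = ρ k • S.w (π k) := by
  have hu : aeval (fun k => ρ k • S.w (π k)) q = 0 := by rw [H, S.w_rel, smul_zero]
  let f0 : Rq q →ₐ[ℝ] B := Ideal.Quotient.liftₐ (Ideal.span {q}) (aeval (fun k => ρ k • S.w (π k)))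
    (by
      intro a ha
      obtain ⟨g, rfl⟩ := Ideal.mem_span_singleton.1 ha
      rw [map_mul, hu, zero_mul])
  have hf0 : ∀ k, f0 (Ideal.Quotient.mk _ (X k)) = ρ k • S.w (π k) := by
    intro k
    change aeval (fun k => ρ k • S.w (π k)) (X k : MvPolynomial (Fin 3) ℝ) = _
    rw [aeval_X]
  let F : ℂ ⊗[ℝ] Rq q →ₐ[ℂ] B := Algebra.TensorProduct.lift (Algebra.ofId ℂ B) f0
    (fun _ _ => Commute.all _ _)
  have hF : ∀ k, F (1 ⊗ₜ Ideal.Quotient.mk _ (X k)) = ρ k • S.w (π k) := by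
    intro k
    simp only [F, Algebra.TensorProduct.lift_tmul, map_one, one_mul, hf0]
  let W : Fin 3 → ℂ ⊗[ℝ] Rq q := fun j => 
    (ρ (π.symm j))⁻¹ • (1 ⊗ₜ Ideal.Quotient.mk _ (X (π.symm j)))
  have hW : ∀ k, ρ k • W (π k) = 1 ⊗ₜ Ideal.Quotient.mk _ (X k) := by
    intro k
    simp only [W, Equiv.symm_apply_apply]
    rw [smul_smul, mul_inv_cancel₀ (hρ k), one_smul]
  have hFW : ∀ j, F (W j) = S.w j := by
    intro j
    simp only [W]
    rw [_root_.map_smul, hF, smul_smul, inv_mul_cancel₀ (hρ _), one_smul, Equiv.apply_symm_apply]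
  have hWr : W 0 ^ 2 - W 1 ^ 2 - W 2 ^ 2 + 1 = 0 := by
    have h := H _ W
    simp only [hW] at h
    rw [aeval_mk] at h
    have := congrArg (fun v => κ⁻¹ • v) h
    simpa [smul_smul, hκ] using this.symm
  let G : B →ₐ[ℂ] ℂ ⊗[ℝ] Rq q := S.lift (W 0 + W 1) (W 0 - W 1) (W 2)
    (by linear_combination hWr)
  have hGx : G S.x = W 0 + W 1 := S.lift_x _ _ _ _
  have hGy : G S.y = W 0 - W 1 := S.lift_y _ _ _ _
  have hGz : G S.z = W 2 := S.lift_z _ _ _ _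
  have hGw : ∀ j, G (S.w j) = W j := by
    intro j
    fin_cases j
    · change G ((1/2 : ℂ) • (S.x + S.y)) = W 0
      rw [_root_.map_smul, map_add, hGx, hGy,
        show W 0 + W 1 + (W 0 - W 1) = (2 : ℂ) • W 0 by rw [two_smul]; ring, smul_smul]; norm_num
    · change G ((1/2 : ℂ) • (S.x - S.y)) = W 1
      rw [_root_.map_smul, map_sub, hGx, hGy,
        show W 0 + W 1 - (W 0 - W 1) = (2 : ℂ) • W 1 by rw [two_smul]; ring, smul_smul]; norm_num
    · exact hGz
  refine ⟨AlgEquiv.ofAlgHom F G ?_ ?_, hF⟩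
  · refine S.hom_ext ?_ ?_ ?_
    · rw [AlgHom.comp_apply, hGx, map_add, hFW, hFW, S.w_x]; rfl
    · rw [AlgHom.comp_apply, hGy, map_sub, hFW, hFW, S.w_y]; rfl
    · rw [AlgHom.comp_apply, hGz, hFW, S.w_z]; rfl
  · apply Algebra.TensorProduct.ext
    · ext
    · apply Ideal.Quotient.algHom_ext
      apply MvPolynomial.algHom_ext
      intro k
      change G (F (1 ⊗ₜ Ideal.Quotient.mk _ (X k))) = 1 ⊗ₜ Ideal.Quotient.mk _ (X k)
      rw [hF, _root_.map_smul, hGw, hW]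

theorem descend [Algebra ℝ B] [IsScalarTower ℝ ℂ B] (t : Inv B) (q : MvPolynomial (Fin 3) ℝ)
    (A : Type) [CommRing A] [Algebra ℝ A] (Θ : ℂ ⊗[ℝ] A ≃ₐ[ℂ] B)
    (hΘ : ∀ u, t.f (Θ u) = Θ (cT A u))
    (F : ℂ ⊗[ℝ] Rq q ≃ₐ[ℂ] B) 
    (hF : ∀ k, t.f (F (1 ⊗ₜ Ideal.Quotient.mk _ (X k))) = F (1 ⊗ₜ Ideal.Quotient.mk _ (X k))) :
    Nonempty (A ≃ₐ[ℝ] Rq q) := by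
  have hF2 : ∀ u, t.f (F u) = F (cT _ u) := by
    let F1 : ℂ ⊗[ℝ] Rq q →ₐ[ℂ] B := 
      { toRingHom := t.f.comp ((F : ℂ ⊗[ℝ] Rq q →+* B).comp (cT (Rq q)).toRingHom)
        commutes' := fun c => by
          change t.f (F (cT _ (algebraMap ℂ _ c))) = _
          rw [cT_alg]
          rw [AlgEquiv.commutes, t.semi, Complex.conj_conj] }
    have hF1 : ∀ u, F1 u = t.f (F (cT _ u)) := fun _ => rfl
    have : F1 = (F : _ →ₐ[ℂ] B) := by
      apply Algebra.TensorProduct.ext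
      · ext
      · apply Ideal.Quotient.algHom_ext
        apply MvPolynomial.algHom_ext
        intro k
        change F1 (1 ⊗ₜ Ideal.Quotient.mk _ (X k)) = F (1 ⊗ₜ Ideal.Quotient.mk _ (X k))
        rw [hF1, cT_tmul, map_one, hF]
    intro u
    have h := DFunLike.congr_fun this (cT _ u)
    rw [hF1, cT_cT] at h
    exact h
  refine descent (Θ.trans F.symm) ?_
  intro u
  rw [AlgEquiv.trans_apply, ← hΘ, AlgEquiv.trans_apply]
  apply F.injective
  rw [AlgEquiv.apply_symm_apply, ← hF2, AlgEquiv.apply_symm_apply]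

noncomputable def invOf {A : Type} [CommRing A] [Algebra ℝ A] (Θ : ℂ ⊗[ℝ] A ≃ₐ[ℂ] B) : Inv B where
  f := (Θ : ℂ ⊗[ℝ] A →+* B).comp ((cT A : ℂ ⊗[ℝ] A →+* ℂ ⊗[ℝ] A).comp (Θ.symm : B →+* ℂ ⊗[ℝ] A))
  invol b := by simp [cT_cT]
  semi c := by
    change Θ (cT A (Θ.symm (algebraMap ℂ B c))) = _
    rw [AlgEquiv.commutes, cT_alg, AlgEquiv.commutes]

theorem invOf_apply {A : Type} [CommRing A] [Algebra ℝ A] (Θ : ℂ ⊗[ℝ] A ≃ₐ[ℂ] B) (b : B) :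
   (invOf Θ).f b = Θ (cT A (Θ.symm b)) := rfl

end Quad
end QF

namespace QF

abbrev QB := MvPolynomial (Fin 3) ℂ ⧸ Ideal.span {(X 0 * X 1 : MvPolynomial (Fin 3) ℂ) - X 2 ^ 2 + 1}

noncomputable def SQ : Quad QB where
  x := Ideal.Quotient.mk _ (X 0)
  y := Ideal.Quotient.mk _ (X 1)
  z := Ideal.Quotient.mk _ (X 2)
  rel := by
    rw [← sub_eq_zero, ← map_mul, ← map_pow, ← map_one (Ideal.Quotient.mk _), ← map_sub, ← map_sub,
      Ideal.Quotient.eq_zero_iff_mem]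
    have := Ideal.mem_span_singleton_self ((X 0 * X 1 : MvPolynomial (Fin 3) ℂ) - X 2 ^ 2 + 1)
    convert this using 1
    ring
  gen := by
    have h : (Algebra.adjoin ℂ (Set.range (X : Fin 3 → MvPolynomial (Fin 3) ℂ))).map
        (Ideal.Quotient.mkₐ ℂ (Ideal.span {(X 0 * X 1 : MvPolynomial (Fin 3) ℂ) - X 2 ^ 2 + 1})) = ⊤ := by
      rw [MvPolynomial.adjoin_range_X, Algebra.map_top, AlgHom.range_eq_top]
      exact Ideal.Quotient.mkₐ_surjective _ _
    rw [← h, AlgHom.map_adjoin]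
    congr 1
    ext v
    constructor
    · rintro (rfl | rfl | rfl)
      · exact ⟨X 0, ⟨0, rfl⟩, rfl⟩
      · exact ⟨X 1, ⟨1, rfl⟩, rfl⟩
      · exact ⟨X 2, ⟨2, rfl⟩, rfl⟩
    · rintro ⟨_, ⟨k, rfl⟩, rfl⟩
      fin_cases k
      · left; rfl
      · right; left; rfl
      · right; right; rfl
  lift {R} _ _ a b c h := Ideal.Quotient.liftₐ _ (aeval ![a, b, c]) (by
      intro f hf
      obtain ⟨g, rfl⟩ := Ideal.mem_span_singleton.1 hf
      rw [map_mul]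
      have : aeval ![a, b, c] ((X 0 * X 1 : MvPolynomial (Fin 3) ℂ) - X 2 ^ 2 + 1) = 0 := by
        simp [h]
      rw [this, zero_mul])
  lift_x a b c h := by
    change aeval ![a, b, c] (X 0 : MvPolynomial (Fin 3) ℂ) = _
    simp
  lift_y a b c h := by
    change aeval ![a, b, c] (X 1 : MvPolynomial (Fin 3) ℂ) = _
    simp
  lift_z a b c h := by
    change aeval ![a, b, c] (X 2 : MvPolynomial (Fin 3) ℂ) = _
    simp

noncomputable instance : Algebra ℝ QB := inferInstance
instance : IsScalarTower ℝ ℂ QB := inferInstance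

theorem Ismul {D : Type} [CommRing D] [Algebra ℂ D] (w : D) : (Complex.I • w) ^ 2 = - w ^ 2 := by
  rw [smul_pow, Complex.I_sq, neg_one_smul]

/-- data for a case: `ρ, π` with target quadric `i`. -/
def Good (i : Fin 4) (ρ : Fin 3 → ℂ) (π : Equiv.Perm (Fin 3)) : Prop :=
  ∃ F : ℂ ⊗[ℝ] Rq (quadric7 i) ≃ₐ[ℂ] QB, ∀ k, F (1 ⊗ₜ Ideal.Quotient.mk _ (X k)) = ρ k • SQ.w (π k)

theorem good1 : Good 2 ![1, 1, 1] (Equiv.swap 0 1) := by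
  refine SQ.realize _ _ _ (-1) (by norm_num) (by intro k; fin_cases k <;> simp) ?_
  intro D _ _ _ _ W
  simp [quadric7, Equiv.swap_apply_def]; ring
theorem good2 : Good 3 ![1, 1, Complex.I] (Equiv.refl _) := by
  refine SQ.realize _ _ _ 1 (by norm_num) (by intro k; fin_cases k <;> simp) ?_
  intro D _ _ _ _ W
  simp [quadric7, Ismul]; ring
theorem good3 : Good 3 ![1, 1, Complex.I] (Equiv.swap 1 2) := by
  refine SQ.realize _ _ _ 1 (by norm_num) (by intro k; fin_cases k <;> simp) ?_
  intro D _ _ _ _ W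
  simp [quadric7, Ismul, Equiv.swap_apply_def]; ring
theorem good4 : Good 0 ![1, Complex.I, Complex.I] (Equiv.refl _) := by
  refine SQ.realize _ _ _ 1 (by norm_num) (by intro k; fin_cases k <;> simp) ?_
  intro D _ _ _ _ W
  simp [quadric7, Ismul]; ring
theorem good5 : Good 1 ![Complex.I, 1, 1] (Equiv.refl _) := by
  refine SQ.realize _ _ _ (-1) (by norm_num) (by intro k; fin_cases k <;> simp) ?_
  intro D _ _ _ _ W
  simp [quadric7, Ismul]; ring
theorem good6 : Good 2 ![Complex.I, Complex.I, 1] (Equiv.swap 1 2) := by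
  refine SQ.realize _ _ _ (-1) (by norm_num) (by intro k; fin_cases k <;> simp) ?_
  intro D _ _ _ _ W
  simp [quadric7, Ismul, Equiv.swap_apply_def]; ring

theorem part2 (i : Fin 4) : IsRealForm (MvPolynomial (Fin 3) ℝ ⧸ Ideal.span {quadric7 i}) QB := by
  fin_cases i
  · exact ⟨good4.choose⟩
  · exact ⟨good5.choose⟩
  · exact ⟨good1.choose⟩
  · exact ⟨good2.choose⟩

theorem part3 (A : Type) [CommRing A] [Algebra ℝ A] (hA : IsRealForm A QB) :
    ∃ i : Fin 4, Nonempty (A ≃ₐ[ℝ] (MvPolynomial (Fin 3) ℝ ⧸ Ideal.span {quadric7 i})) := by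
  obtain ⟨Θ⟩ := hA
  obtain ⟨e, h1, h2⟩ := SQ.normal (Quad.invOf Θ)
  have hΘ : ∀ u, ((Quad.invOf Θ).cj e).f ((Θ.trans e.symm) u) = (Θ.trans e.symm) (cT A u) := by
    intro u
    rw [Inv.cj_apply, AlgEquiv.trans_apply, AlgEquiv.apply_symm_apply, Quad.invOf_apply,
      AlgEquiv.symm_apply_apply, AlgEquiv.trans_apply]
  generalize (Quad.invOf Θ).cj e = t at h1 h2 hΘ
  have fin : ∀ i ρ π, Good i ρ π → (∀ k, t.f (ρ k • SQ.w (π k)) = ρ k • SQ.w (π k)) →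
      ∃ i : Fin 4, Nonempty (A ≃ₐ[ℝ] (MvPolynomial (Fin 3) ℝ ⧸ Ideal.span {quadric7 i})) := by
    rintro i ρ π ⟨F, hF⟩ h
    exact ⟨i, Quad.descend t _ A (Θ.trans e.symm) hΘ F (by intro k; rw [hF, h])⟩
  have w0 : SQ.w 0 = (1/2 : ℂ) • (SQ.x + SQ.y) := rfl
  have w1 : SQ.w 1 = (1/2 : ℂ) • (SQ.x - SQ.y) := rfl
  have w2 : SQ.w 2 = SQ.z := rfl
  have hh : starRingEnd ℂ (1/2) = 1/2 := by simp [map_ofNat]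
  rcases h1 with ⟨hx, hy⟩ | ⟨hx, hy⟩ | ⟨hx, hy⟩
  · have t0 : t.f (SQ.w 0) = SQ.w 0 := by rw [w0, t.map_smul, hh, map_add, hx, hy]
    have t1 : t.f (SQ.w 1) = SQ.w 1 := by rw [w1, t.map_smul, hh, map_sub, hx, hy]
    rcases h2 with hz | hz <;> rw [← w2] at hz
    · refine fin _ _ _ good1 ?_
      intro k; fin_cases k <;> simp [Equiv.swap_apply_def, t.map_smul, t0, t1, hz]
    · refine fin _ _ _ good2 ?_
      intro k; fin_cases k <;> simp [t.map_smul, t0, t1, hz]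
  · have t0 : t.f (SQ.w 0) = SQ.w 0 := by rw [w0, t.map_smul, hh, map_add, hx, hy, add_comm SQ.y SQ.x]
    have t1 : t.f (SQ.w 1) = - SQ.w 1 := by rw [w1, t.map_smul, hh, map_sub, hx, hy, ← smul_neg, neg_sub]
    rcases h2 with hz | hz <;> rw [← w2] at hz
    · refine fin _ _ _ good3 ?_
      intro k; fin_cases k <;> simp [Equiv.swap_apply_def, t.map_smul, t0, t1, hz]
    · refine fin _ _ _ good4 ?_
      intro k; fin_cases k <;> simp [t.map_smul, t0, t1, hz]
  · have t0 : t.f (SQ.w 0) = - SQ.w 0 := by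
      rw [w0, t.map_smul, hh, map_add, hx, hy, ← smul_neg]; congr 1; ring
    have t1 : t.f (SQ.w 1) = SQ.w 1 := by
      rw [w1, t.map_smul, hh, map_sub, hx, hy]; congr 1; ring
    rcases h2 with hz | hz <;> rw [← w2] at hz
    · refine fin _ _ _ good5 ?_
      intro k; fin_cases k <;> simp [t.map_smul, t0, t1, hz]
    · refine fin _ _ _ good6 ?_
      intro k; fin_cases k <;> simp [Equiv.swap_apply_def, t.map_smul, t0, t1, hz]

end QF

namespace QF

theorem aev (p : Fin 3 → ℝ) (g : MvPolynomial (Fin 3) ℝ) : aeval p g = MvPolynomial.eval p g := by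
  rw [← MvPolynomial.coe_aeval_eq_eval]; rfl

noncomputable def pt {q : MvPolynomial (Fin 3) ℝ} (p : Fin 3 → ℝ) (h : aeval p q = 0) : Rq q →ₐ[ℝ] ℝ :=
  Ideal.Quotient.liftₐ _ (aeval p) (by
      intro f hf
      obtain ⟨g, rfl⟩ := Ideal.mem_span_singleton.1 hf
      rw [map_mul, h, zero_mul])

theorem pt_mk {q : MvPolynomial (Fin 3) ℝ} (p : Fin 3 → ℝ) (h : aeval p q = 0) (g) :
    pt p h (Ideal.Quotient.mk _ g) = aeval p g := rfl

theorem exists_pt {q : MvPolynomial (Fin 3) ℝ} (φ : Rq q →ₐ[ℝ] ℝ) :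
    ∃ p : Fin 3 → ℝ, aeval p q = 0 ∧ ∀ g, φ (Ideal.Quotient.mk _ g) = aeval p g := by
  have h : ∀ g, φ (Ideal.Quotient.mk _ g) = aeval (fun k => φ (Ideal.Quotient.mk _ (X k))) g := by
    have : φ.comp (Ideal.Quotient.mkₐ ℝ _) = aeval (fun k => φ (Ideal.Quotient.mk _ (X k))) := by
      apply MvPolynomial.algHom_ext
      intro k
      rw [aeval_X]; rfl
    intro g
    exact DFunLike.congr_fun this g
  refine ⟨_, ?_, h⟩
  rw [← h, Ideal.Quotient.eq_zero_iff_mem.2 (Ideal.mem_span_singleton_self q), map_zero]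

def P1 (R : Type) [CommRing R] [Algebra ℝ R] : Prop := Nonempty (R →ₐ[ℝ] ℝ)
def P2 (R : Type) [CommRing R] [Algebra ℝ R] : Prop := ∀ f : R, ∃ M : ℝ, ∀ φ : R →ₐ[ℝ] ℝ, φ f ≤ M
def P3 (R : Type) [CommRing R] [Algebra ℝ R] : Prop := ∃ f : R, (∀ φ : R →ₐ[ℝ] ℝ, φ f ≠ 0) ∧
  (∃ φ : R →ₐ[ℝ] ℝ, φ f < 0) ∧ ∃ φ : R →ₐ[ℝ] ℝ, 0 < φ f

section
variable {R R' : Type} [CommRing R] [Algebra ℝ R] [CommRing R'] [Algebra ℝ R']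
theorem P1_tr (e : R ≃ₐ[ℝ] R') (h : P1 R) : P1 R' := by
  obtain ⟨φ⟩ := h
  exact ⟨φ.comp (e.symm : R' →ₐ[ℝ] R)⟩
theorem P2_tr (e : R ≃ₐ[ℝ] R') (h : P2 R) : P2 R' := by
  intro f
  obtain ⟨M, hM⟩ := h (e.symm f)
  refine ⟨M, fun φ => ?_⟩
  have := hM (φ.comp (e : R →ₐ[ℝ] R'))
  simpa using this
theorem P3_tr (e : R ≃ₐ[ℝ] R') (h : P3 R) : P3 R' := by
  obtain ⟨f, h1, ⟨φ, h2⟩, ⟨ψ, h3⟩⟩ := h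
  refine ⟨e f, ?_, ⟨φ.comp (e.symm : R' →ₐ[ℝ] R), by simpa using h2⟩,
    ⟨ψ.comp (e.symm : R' →ₐ[ℝ] R), by simpa using h3⟩⟩
  intro φ
  exact h1 (φ.comp (e : R →ₐ[ℝ] R'))
end

theorem not_P1_0 : ¬ P1 (Rq (quadric7 0)) := by
  rintro ⟨φ⟩
  obtain ⟨p, h, -⟩ := exists_pt φ
  simp [quadric7] at h
  nlinarith [sq_nonneg (p 0), sq_nonneg (p 1), sq_nonneg (p 2)]

theorem P1_1 : P1 (Rq (quadric7 1)) := ⟨pt ![1, 0, 0] (by simp [quadric7])⟩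
theorem P1_2 : P1 (Rq (quadric7 2)) := ⟨pt ![1, 0, 0] (by simp [quadric7])⟩
theorem P1_3 : P1 (Rq (quadric7 3)) := ⟨pt ![0, 1, 0] (by simp [quadric7])⟩

theorem P2_1 : P2 (Rq (quadric7 1)) := by
  intro f
  obtain ⟨g, rfl⟩ := Ideal.Quotient.mk_surjective f
  have hc : IsCompact (Set.Icc (-1) 1 : Set (Fin 3 → ℝ)) := isCompact_Icc
  obtain ⟨M, hM⟩ := hc.bddAbove_image (f := fun p => MvPolynomial.eval p g)
    (MvPolynomial.continuous_eval g).continuousOn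
  refine ⟨M, fun φ => ?_⟩
  obtain ⟨p, h, hφ⟩ := exists_pt φ
  rw [hφ, aev]
  apply hM
  refine ⟨p, ?_, rfl⟩
  simp [quadric7] at h
  constructor <;> intro k <;> fin_cases k <;> simp <;>
    nlinarith [sq_nonneg (p 0), sq_nonneg (p 1), sq_nonneg (p 2)]

theorem not_P2_2 : ¬ P2 (Rq (quadric7 2)) := by
  intro h
  obtain ⟨M, hM⟩ := h (Ideal.Quotient.mk _ (X 1))
  have := hM (pt ![√(1 + (M + 1) ^ 2), M + 1, 0] (by
    have := Real.sq_sqrt (show 0 ≤ 1 + (M + 1) ^ 2 by positivity)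
    simp [quadric7, this]))
  rw [pt_mk] at this
  simp at this
  linarith

theorem not_P2_3 : ¬ P2 (Rq (quadric7 3)) := by
  intro h
  obtain ⟨M, hM⟩ := h (Ideal.Quotient.mk _ (X 1))
  have hs := Real.sq_sqrt (show 0 ≤ 1 + M ^ 2 by positivity)
  have := hM (pt ![M, √(1 + M ^ 2), 0] (by
    simp [quadric7, hs]))
  rw [pt_mk] at this
  simp at this
  nlinarith [Real.sqrt_nonneg (1 + M ^ 2)]

theorem P3_3 : P3 (Rq (quadric7 3)) := by
  refine ⟨Ideal.Quotient.mk _ (X 1), ?_, ⟨pt ![0, -1, 0] (by simp [quadric7]), ?_⟩,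
    ⟨pt ![0, 1, 0] (by simp [quadric7]), ?_⟩⟩
  · intro φ h0
    obtain ⟨p, h, hφ⟩ := exists_pt φ
    rw [hφ] at h0
    simp [quadric7] at h h0
    rw [h0] at h
    nlinarith [sq_nonneg (p 0), sq_nonneg (p 2)]
  · rw [pt_mk]; simp
  · rw [pt_mk]; simp

theorem not_P3_2 : ¬ P3 (Rq (quadric7 2)) := by
  rintro ⟨f, h1, ⟨φ, h2⟩, ⟨ψ, h3⟩⟩
  obtain ⟨g, rfl⟩ := Ideal.Quotient.mk_surjective f
  let P : ℝ × ℝ → Fin 3 → ℝ := fun v =>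
    ![√(1 + v.1 ^ 2) * Real.cos v.2, v.1, √(1 + v.1 ^ 2) * Real.sin v.2]
  have hP : Continuous P := by
    refine continuous_pi fun k => ?_
    fin_cases k <;> simp [P] <;> fun_prop
  have hPq : ∀ v, aeval (P v) (quadric7 2) = 0 := by
    intro v
    have := Real.sq_sqrt (show 0 ≤ 1 + v.1 ^ 2 by positivity)
    have h2 := Real.sin_sq_add_cos_sq v.2
    simp [quadric7, P]
    linear_combination (Real.cos v.2 ^ 2 + Real.sin v.2 ^ 2) * this + (1 + v.1 ^ 2) * h2
  have hsurj : ∀ p : Fin 3 → ℝ, aeval p (quadric7 2) = 0 → ∃ v, P v = p := by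
    intro p h
    simp [quadric7] at h
    let c : ℂ := ⟨p 0, p 2⟩
    have hn : ‖c‖ = √(1 + p 1 ^ 2) := by
      rw [Complex.norm_def, Complex.normSq_mk]
      congr 1
      linear_combination h
    refine ⟨(p 1, c.arg), ?_⟩
    funext k
    fin_cases k
    · change √(1 + p 1 ^ 2) * Real.cos c.arg = p 0
      rw [← hn, Complex.norm_mul_cos_arg]
    · rfl
    · change √(1 + p 1 ^ 2) * Real.sin c.arg = p 2
      rw [← hn, Complex.norm_mul_sin_arg]
  have hcont : Continuous (fun v => MvPolynomial.eval (P v) g) :=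
    (MvPolynomial.continuous_eval g).comp hP
  have ex : ∀ φ : Rq (quadric7 2) →ₐ[ℝ] ℝ, ∃ v, MvPolynomial.eval (P v) g =
      φ (Ideal.Quotient.mk _ g) := by
    intro φ
    obtain ⟨p, h, hφ⟩ := exists_pt φ
    obtain ⟨v, rfl⟩ := hsurj p h
    refine ⟨v, ?_⟩
    rw [hφ, aev]
  obtain ⟨a, ha⟩ := ex φ
  obtain ⟨b, hb⟩ := ex ψ
  obtain ⟨v, hv⟩ := mem_range_of_exists_le_of_exists_ge hcont ⟨a, (ha.trans_lt h2).le⟩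
    ⟨b, (h3.trans_eq hb.symm).le⟩
  apply h1 (pt (P v) (hPq v))
  rw [pt_mk, aev]
  exact hv

theorem part1 (i j : Fin 4) (hij : i ≠ j) : IsEmpty (Rq (quadric7 i) ≃ₐ[ℝ] Rq (quadric7 j)) := by
  constructor
  intro e
  fin_cases i <;> fin_cases j
  · exact hij rfl
  · exact not_P1_0 (P1_tr e.symm P1_1)
  · exact not_P1_0 (P1_tr e.symm P1_2)
  · exact not_P1_0 (P1_tr e.symm P1_3)
  · exact not_P1_0 (P1_tr e P1_1)
  · exact hij rfl
  · exact not_P2_2 (P2_tr e P2_1)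
  · exact not_P2_3 (P2_tr e P2_1)
  · exact not_P1_0 (P1_tr e P1_2)
  · exact not_P2_2 (P2_tr e.symm P2_1)
  · exact hij rfl
  · exact not_P3_2 (P3_tr e.symm P3_3)
  · exact not_P1_0 (P1_tr e P1_3)
  · exact not_P2_3 (P2_tr e.symm P2_1)
  · exact not_P3_2 (P3_tr e P3_3)
  · exact hij rfl

end QF

/-- The complex surface `xy = z² - 1` has exactly four isomorphism classes of real
forms, given by `x² ± y² + z² ± 1 = 0`. -/
theorem four_real_forms_of_quadric :
    (∀ i j : Fin 4, i ≠ j →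
      IsEmpty ((MvPolynomial (Fin 3) ℝ ⧸ Ideal.span {quadric7 i}) ≃ₐ[ℝ]
               (MvPolynomial (Fin 3) ℝ ⧸ Ideal.span {quadric7 j}))) ∧
    (∀ i : Fin 4,
      IsRealForm (MvPolynomial (Fin 3) ℝ ⧸ Ideal.span {quadric7 i})
        (MvPolynomial (Fin 3) ℂ ⧸
          Ideal.span {(X 0 * X 1 : MvPolynomial (Fin 3) ℂ) - X 2 ^ 2 + 1})) ∧
    (∀ (A : Type) [CommRing A] [Algebra ℝ A],
      IsRealForm A (MvPolynomial (Fin 3) ℂ ⧸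
          Ideal.span {(X 0 * X 1 : MvPolynomial (Fin 3) ℂ) - X 2 ^ 2 + 1}) →
      ∃ i : Fin 4, Nonempty (A ≃ₐ[ℝ] (MvPolynomial (Fin 3) ℝ ⧸ Ideal.span {quadric7 i}))) := by
  exact ⟨QF.part1, QF.part2, fun A _ _ h => QF.part3 A h⟩
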